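/- arXiv:2309.05182 — 4 statements merged into one kernel-verified Lean document; each statement's English description precedes it below -/
import Mathlib

section
/- Fix a community labeling σ : [n] → [k] and a permutation π_* of [n] with lifted permutation τ_* = ℓ(π_*). Let p = p(n) = o(1), q = q(n) = o(1), s ∈ [0,1], and set θ = max(√p, √q). Then for every constant ε ∈ (0,1) and all reals 1 ≤ ω ≤ 3 and 1 ≤ ζ ≤ 3, there exists N such that for all n ≥ N and every permutation π of [n] with lifted permutation τ = ℓ(π), the conditional probability generating function satisfies E[θ^{X(τ)} · ω^{Y⁺(τ)} · ζ^{Y⁻(τ)}] ≤ exp(−(1−ε)·s²·(p·M⁺(τ) + q·M⁻(τ))). -/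
open Finset Filter

namespace CSBM

/-- Unordered pairs of distinct vertices of `[n]`, encoded as ordered pairs `(i,j)` with `i < j`. -/
abbrev Edge (n : ℕ) := {e : Fin n × Fin n // e.1 < e.2}

/-- Bernoulli weight: probability of outcome `b` under a `Bernoulli(p)` variable. -/
noncomputable def bern (p : ℝ) (b : Bool) : ℝ := if b then p else 1 - p

/-- Edge indicator between two vertices for a graph encoded on ordered pairs `i < j`. -/
def adj {n : ℕ} (g : Edge n → Bool) (i j : Fin n) : Bool :=
  if h : i < j then g ⟨(i, j), h⟩ else if h' : j < i then g ⟨(j, i), h'⟩ else false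

/-- The lifted permutation `ℓ(π)` acting on unordered pairs. -/
def lift {n : ℕ} (π : Equiv.Perm (Fin n)) (e : Edge n) : Edge n :=
  if h : π e.1.1 < π e.1.2 then ⟨(π e.1.1, π e.1.2), h⟩
  else ⟨(π e.1.2, π e.1.1),
    lt_of_le_of_ne (not_lt.mp h) fun hc => e.2.ne' (π.injective hc)⟩

/-- Outcome of the correlated SBM: community labels, parent graph, and two subsampling masks. -/
abbrev Omega (n k : ℕ) := (Fin n → Fin k) × (Edge n → Bool) × (Edge n → Bool) × (Edge n → Bool)

/-- Joint density (probability mass) of `CSBM(n,p,q,k,s)`: labels i.i.d. uniform on `[k]`,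
parent edges Bernoulli `p`/`q` according to labels, two independent `s`-subsampling masks. -/
noncomputable def density (n k : ℕ) (p q s : ℝ) (ω : Omega n k) : ℝ :=
  ((k : ℝ))⁻¹ ^ n
    * (∏ e : Edge n, bern (if ω.1 e.1.1 = ω.1 e.1.2 then p else q) (ω.2.1 e))
    * (∏ e : Edge n, bern s (ω.2.2.1 e))
    * (∏ e : Edge n, bern s (ω.2.2.2 e))

/-- Probability of an event under `CSBM(n,p,q,k,s)` (with the ground-truth permutation being
a fixed parameter, entering only through observables). -/
noncomputable def Pr (n k : ℕ) (p q s : ℝ) (A : Set (Omega n k)) : ℝ :=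
  ∑ ω : Omega n k, Set.indicator A (density n k p q s) ω

/-- Adjacency matrix of `G₁` (first subsample of the parent graph). -/
def G1adj {n k : ℕ} (ω : Omega n k) : Fin n → Fin n → Bool :=
  fun i j => adj ω.2.1 i j && adj ω.2.2.1 i j

/-- Adjacency matrix of `G₂'` (second subsample of the parent graph, unpermuted). -/
def G2primeAdj {n k : ℕ} (ω : Omega n k) : Fin n → Fin n → Bool :=
  fun i j => adj ω.2.1 i j && adj ω.2.2.2 i j

/-- Adjacency matrix of `G₂`: the second subsample with vertices relabeled by `π`. -/
def G2adj {n k : ℕ} (π : Equiv.Perm (Fin n)) (ω : Omega n k) : Fin n → Fin n → Bool :=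
  fun i j => G2primeAdj ω (π.symm i) (π.symm j)

/-- Alignment score `Σ_{i<j} A_{i,j} B_{π(i),π(j)}`. -/
def align {n : ℕ} (A B : Fin n → Fin n → Bool) (π : Equiv.Perm (Fin n)) : ℕ :=
  ∑ e : Edge n, (if A e.1.1 e.1.2 && B (π e.1.1) (π e.1.2) then 1 else 0)


/-- Outcome of the correlated SBM conditionally on the labels: parent graph and two masks. -/
abbrev CondOmega (n : ℕ) := (Edge n → Bool) × (Edge n → Bool) × (Edge n → Bool)

/-- Conditional density of the correlated SBM given the community labeling `σ`. -/
noncomputable def condDensity (n k : ℕ) (σ : Fin n → Fin k) (p q s : ℝ)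
    (ω : CondOmega n) : ℝ :=
  (∏ e : Edge n, bern (if σ e.1.1 = σ e.1.2 then p else q) (ω.1 e))
    * (∏ e : Edge n, bern s (ω.2.1 e))
    * (∏ e : Edge n, bern s (ω.2.2 e))

/-- Conditional probability of an event given the labels `σ` (and the ground truth `π⋆`,
which enters only through observables). -/
noncomputable def condPr (n k : ℕ) (σ : Fin n → Fin k) (p q s : ℝ)
    (A : Set (CondOmega n)) : ℝ :=
  ∑ ω : CondOmega n, Set.indicator A (condDensity n k σ p q s) ω

/-- Adjacency matrix of `G₁` in the conditional model. -/
def G1adjC {n : ℕ} (ω : CondOmega n) : Fin n → Fin n → Bool :=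
  fun i j => adj ω.1 i j && adj ω.2.1 i j

/-- Adjacency matrix of `G₂` (second subsample, relabeled by `π⋆`) in the conditional model. -/
def G2adjC {n : ℕ} (πstar : Equiv.Perm (Fin n)) (ω : CondOmega n) : Fin n → Fin n → Bool :=
  fun i j => adj ω.1 (πstar.symm i) (πstar.symm j) && adj ω.2.2 (πstar.symm i) (πstar.symm j)

/-- `|V_r|`: size of the `r`-th community. -/
def Vcard {n k : ℕ} (σ : Fin n → Fin k) (r : Fin k) : ℕ :=
  (univ.filter fun i => σ i = r).card

/-- `x_r`: number of vertices of community `r` mismatched by `π` relative to `π⋆`. -/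
def xcount {n k : ℕ} (σ : Fin n → Fin k) (πstar π : Equiv.Perm (Fin n)) (r : Fin k) : ℕ :=
  (univ.filter fun i => σ i = r ∧ π i ≠ πstar i).card

/-- `M⁺(τ)`: number of intra-community pairs moved differently by `ℓ(π)` and `ℓ(π⋆)`. -/
def Mplus {n k : ℕ} (σ : Fin n → Fin k) (πstar π : Equiv.Perm (Fin n)) : ℕ :=
  (univ.filter fun e : Edge n => σ e.1.1 = σ e.1.2 ∧ lift π e ≠ lift πstar e).card

/-- `M⁻(τ)`: number of inter-community pairs moved differently by `ℓ(π)` and `ℓ(π⋆)`. -/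
def Mminus {n k : ℕ} (σ : Fin n → Fin k) (πstar π : Equiv.Perm (Fin n)) : ℕ :=
  (univ.filter fun e : Edge n => σ e.1.1 ≠ σ e.1.2 ∧ lift π e ≠ lift πstar e).card


/-- Real value of a Boolean. -/
noncomputable def b2r (b : Bool) : ℝ := if b then 1 else 0

/-- `A_e` in the conditional model. -/
def AvalC {n : ℕ} (ω : CondOmega n) (e : Edge n) : Bool := ω.1 e && ω.2.1 e

/-- `B_f`: the entry of `G₂`'s adjacency at the pair `f` in the conditional model. -/
def BvalC {n : ℕ} (πstar : Equiv.Perm (Fin n)) (ω : CondOmega n) (f : Edge n) : Bool :=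
  ω.1 (lift πstar.symm f) && ω.2.2 (lift πstar.symm f)

/-- `X(τ) = Σ_{e : τ(e) ≠ τ⋆(e)} (A_e B_{τ⋆(e)} - A_e B_{τ(e)})`. -/
noncomputable def Xvar {n : ℕ} (πstar π : Equiv.Perm (Fin n)) (ω : CondOmega n) : ℝ :=
  ∑ e ∈ univ.filter (fun e : Edge n => lift π e ≠ lift πstar e),
    (b2r (AvalC ω e) * b2r (BvalC πstar ω (lift πstar e))
      - b2r (AvalC ω e) * b2r (BvalC πstar ω (lift π e)))

/-- `Y⁺(τ) = Σ_{e ∈ 𝓔⁺(σ) : τ(e) ≠ τ⋆(e)} A_e B_{τ⋆(e)}`. -/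
noncomputable def Yplus {n k : ℕ} (σ : Fin n → Fin k) (πstar π : Equiv.Perm (Fin n))
    (ω : CondOmega n) : ℝ :=
  ∑ e ∈ univ.filter (fun e : Edge n => σ e.1.1 = σ e.1.2 ∧ lift π e ≠ lift πstar e),
    b2r (AvalC ω e) * b2r (BvalC πstar ω (lift πstar e))

/-- `Y⁻(τ) = Σ_{e ∈ 𝓔⁻(σ) : τ(e) ≠ τ⋆(e)} A_e B_{τ⋆(e)}`. -/
noncomputable def Yminus {n k : ℕ} (σ : Fin n → Fin k) (πstar π : Equiv.Perm (Fin n))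
    (ω : CondOmega n) : ℝ :=
  ∑ e ∈ univ.filter (fun e : Edge n => σ e.1.1 ≠ σ e.1.2 ∧ lift π e ≠ lift πstar e),
    b2r (AvalC ω e) * b2r (BvalC πstar ω (lift πstar e))

/-- The conditional probability generating function `E[θ^{X(τ)} ω^{Y⁺(τ)} ζ^{Y⁻(τ)} | σ, τ⋆]`. -/
noncomputable def PGF (n k : ℕ) (σ : Fin n → Fin k) (p q s : ℝ)
    (πstar π : Equiv.Perm (Fin n)) (θ w ζ : ℝ) : ℝ :=
  ∑ ω : CondOmega n, condDensity n k σ p q s ω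
    * θ ^ Xvar πstar π ω * w ^ Yplus σ πstar π ω * ζ ^ Yminus σ πstar π ω

/-- Closed class of nonnegative two-by-two matrices. -/
structure GoodM (r t : ℝ) (T : Bool → Bool → ℝ) : Prop where
  i1 : T false false + T false true * t + T true false * r + r * t * T true true ≤ 1
  i2 : T false true + r * T true true ≤ r
  i3 : T true false + t * T true true ≤ t
  i4 : T true true ≤ r * t

/-- two-by-two matrix product -/
noncomputable def mulM (T S : Bool → Bool → ℝ) (i j : Bool) : ℝ :=
  T i false * S false j + T i true * S true j

lemma GoodM.trace {r t : ℝ} (hr : 0 ≤ r) (ht : 0 ≤ t) {T S : Bool → Bool → ℝ}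
    (hT0 : ∀ i j, 0 ≤ T i j) (hS0 : ∀ i j, 0 ≤ S i j)
    (hT : GoodM r t T) (hS : GoodM r t S) :
    mulM T S false false + mulM T S true true ≤ 1 := by
  obtain ⟨a1, a2, a3, a4⟩ := hT
  obtain ⟨b1, b2, b3, b4⟩ := hS
  have h1 := hT0 false false
  have h2 := hT0 false true
  have h3 := hT0 true false
  have h4 := hT0 true true
  have k1 := hS0 false false
  have k2 := hS0 false true
  have k3 := hS0 true false
  have k4 := hS0 true true
  unfold mulM
  generalize T false false = a at *
  generalize T false true = b at *
  generalize T true false = c at *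
  generalize T true true = d at *
  generalize S false false = a' at *
  generalize S false true = b' at *
  generalize S true false = c' at *
  generalize S true true = d' at *
  have hy : 0 ≤ r * t := mul_nonneg hr ht
  have hrd := mul_nonneg hr h4
  have htd := mul_nonneg ht h4
  have hrd' := mul_nonneg hr k4
  have htd' := mul_nonneg ht k4
  have e1 : 0 ≤ b * t := by positivity
  have e2 : 0 ≤ c * r := by positivity
  have e3 : 0 ≤ r * t * d := by positivity
  have e1' : 0 ≤ b' * t := by positivity
  have e2' : 0 ≤ c' * r := by positivity
  have e3' : 0 ≤ r * t * d' := by positivity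
  have q1 : a * a' ≤ a := by nlinarith
  have q1' : a * a' ≤ a' := by nlinarith
  have q2 : b * c' ≤ b * t := mul_le_mul_of_nonneg_left (by linarith) h2
  have q2' : b * c' ≤ r * c' := mul_le_mul_of_nonneg_right (by linarith) k3
  have q3 : c * b' ≤ c * r := mul_le_mul_of_nonneg_left (by linarith) h3
  have q3' : c * b' ≤ t * b' := mul_le_mul_of_nonneg_right (by linarith) k2
  have q4 : d * d' ≤ d * (r * t) := mul_le_mul_of_nonneg_left b4 h4
  have q4' : d * d' ≤ (r * t) * d' := mul_le_mul_of_nonneg_right a4 k4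
  linarith

lemma GoodM.mul {r t : ℝ} (hr : 0 ≤ r) (ht : 0 ≤ t) (hy1 : r * t ≤ 1) {T S : Bool → Bool → ℝ}
    (hT0 : ∀ i j, 0 ≤ T i j) (hS0 : ∀ i j, 0 ≤ S i j)
    (hT : GoodM r t T) (hS : GoodM r t S) : GoodM r t (mulM T S) := by
  obtain ⟨a1, a2, a3, a4⟩ := hT
  obtain ⟨b1, b2, b3, b4⟩ := hS
  have h1 := hT0 false false
  have h2 := hT0 false true
  have h3 := hT0 true false
  have h4 := hT0 true true
  have k1 := hS0 false false
  have k2 := hS0 false true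
  have k3 := hS0 true false
  have k4 := hS0 true true
  suffices h : (mulM T S false false + mulM T S false true * t + mulM T S true false * r
      + r * t * mulM T S true true ≤ 1) ∧ (mulM T S false true + r * mulM T S true true ≤ r) ∧
      (mulM T S true false + t * mulM T S true true ≤ t) ∧ (mulM T S true true ≤ r * t) from
    ⟨h.1, h.2.1, h.2.2.1, h.2.2.2⟩
  unfold mulM
  generalize T false false = a at *
  generalize T false true = b at *
  generalize T true false = c at *
  generalize T true true = d at *
  generalize S false false = a' at *
  generalize S false true = b' at *
  generalize S true false = c' at *
  generalize S true true = d' at *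
  have hy : 0 ≤ r * t := mul_nonneg hr ht
  have hrd := mul_nonneg hr h4
  have htd := mul_nonneg ht h4
  have hrd' := mul_nonneg hr k4
  have htd' := mul_nonneg ht k4
  have e1 : 0 ≤ b * t := by positivity
  have e2 : 0 ≤ c * r := by positivity
  have e3 : 0 ≤ r * t * d := by positivity
  have e1' : 0 ≤ b' * t := by positivity
  have e2' : 0 ≤ c' * r := by positivity
  have e3' : 0 ≤ r * t * d' := by positivity
  refine ⟨?_, ?_, ?_, ?_⟩
  · have u1 : a * (a' + b' * t) ≤ a * 1 := mul_le_mul_of_nonneg_left (by linarith) h1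
    have u2 : b * (c' + t * d') ≤ b * t := mul_le_mul_of_nonneg_left b3 h2
    have u3 : c * r * (a' + b' * t) ≤ c * r * 1 := mul_le_mul_of_nonneg_left (by linarith) e2
    have u4 : r * d * (c' + t * d') ≤ r * d * t := mul_le_mul_of_nonneg_left b3 hrd
    linarith
  · have u1 : (a + r * c) * b' ≤ 1 * b' := mul_le_mul_of_nonneg_right (by linarith) k2
    have u2 : (b + r * d) * d' ≤ r * d' := mul_le_mul_of_nonneg_right a2 k4
    linarith
  · have u1 : c * (a' + t * b') ≤ c * 1 := mul_le_mul_of_nonneg_left (by linarith) h3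
    have u2 : d * (c' + t * d') ≤ d * t := mul_le_mul_of_nonneg_left b3 h4
    linarith
  · have u1 : c * b' ≤ t * b' := mul_le_mul_of_nonneg_right (by linarith) k2
    have u2 : t * (b' + r * d') ≤ t * r := mul_le_mul_of_nonneg_left b2 ht
    have u3 : d * d' ≤ r * t * d' := mul_le_mul_of_nonneg_right a4 k4
    linarith

lemma sum_flip {V : Type*} [Fintype V] [DecidableEq V] (v : V) (F F' : (V → Bool) → ℝ)
    (h : ∀ y, F (Function.update y v false) + F (Function.update y v true)
      = F' (Function.update y v false) + F' (Function.update y v true)) :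
    ∑ y, F y = ∑ y, F' y := by
  have inv : Function.Involutive (fun y : V → Bool => Function.update y v (!(y v))) := by
    intro y; simp
  have key : ∀ G : (V → Bool) → ℝ, 2 * ∑ y, G y
      = ∑ y, (G (Function.update y v false) + G (Function.update y v true)) := by
    intro G
    have e1 : ∑ y, G (Function.update y v (!(y v))) = ∑ y, G y :=
      Equiv.sum_comp inv.toPerm G
    rw [two_mul]
    nth_rewrite 2 [← e1]
    rw [← Finset.sum_add_distrib]
    refine Finset.sum_congr rfl fun y _ => ?_
    have hy : Function.update y v (y v) = y := Function.update_eq_self v y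
    cases hb : y v
    · rw [hb] at hy; simp [hy]
    · rw [hb] at hy; simp [hy]; ring
  have := key F
  have := key F'
  have : ∑ y, (F (Function.update y v false) + F (Function.update y v true))
      = ∑ y, (F' (Function.update y v false) + F' (Function.update y v true)) :=
    Finset.sum_congr rfl fun y _ => h y
  linarith

lemma Z_bound {V : Type*} [Fintype V] [DecidableEq V] {r t : ℝ} (hr : 0 ≤ r) (ht : 0 ≤ t)
    (hy1 : r * t ≤ 1) : ∀ (m : ℕ) (ρ : Equiv.Perm V), ρ.support.card = m →
    ∀ T : V → Bool → Bool → ℝ, (∀ e i j, 0 ≤ T e i j) →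
      (∀ e, ρ e ≠ e → GoodM r t (T e)) →
      (∀ e, ρ e = e → T e false false + T e true true ≤ 1) →
      ∑ y : V → Bool, ∏ e, T e (y e) (y (ρ e)) ≤ 1 := by
  intro m
  induction m using Nat.strong_induction_on with
  | _ m ih =>
  intro ρ hm T T0 TG Tt
  by_cases h1 : ρ = 1
  · subst h1
    have : ∑ y : V → Bool, ∏ e, T e (y e) (y ((1 : Equiv.Perm V) e))
        = ∏ e, ∑ b, T e b b := by
      rw [Finset.prod_univ_sum, Fintype.piFinset_univ]; rfl
    rw [this]
    refine Finset.prod_le_one (fun e _ => Finset.sum_nonneg fun b _ => T0 _ _ _) fun e _ => ?_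
    have := Tt e rfl
    simp only [Fintype.sum_bool]; linarith
  · obtain ⟨e', he'⟩ : ∃ e', ρ e' ≠ e' := by
      by_contra! hc; exact h1 (Equiv.ext hc)
    obtain ⟨e, he⟩ := ρ.surjective e'
    have hne : e ≠ e' := by rintro rfl; exact he' he
    set ρ' := Equiv.swap e' (ρ e') * ρ with hρ'
    have r1 : ρ' e = ρ e' := by simp [hρ', he]
    have r2 : ρ' e' = e' := by simp [hρ']
    have r3 : ∀ v, v ≠ e → v ≠ e' → ρ' v = ρ v := by
      intro v h1 h2
      simp only [hρ', Equiv.Perm.mul_apply]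
      refine Equiv.swap_apply_of_ne_of_ne ?_ ?_
      · rw [← he]; exact fun h => h1 (ρ.injective h)
      · exact fun h => h2 (ρ.injective h)
    set T' : V → Bool → Bool → ℝ := fun v => if v = e then mulM (T e) (T e') else
      if v = e' then fun i j => if i = false ∧ j = false then 1 else 0 else T v with hT'
    have T'e : T' e = mulM (T e) (T e') := by simp [hT']
    have T'e' : T' e' = fun i j => if i = false ∧ j = false then 1 else 0 := by
      simp [hT', hne.symm]
    have T'v : ∀ v, v ≠ e → v ≠ e' → T' v = T v := by
      intro v h1 h2; simp [hT', h1, h2]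
    have hρe : ρ e ≠ e := by rw [he]; exact hne.symm
    have hcard : ρ'.support.card < m := by
      rw [← hm]; exact Equiv.Perm.card_support_swap_mul he'
    have main := ih _ hcard ρ' rfl T' ?_ ?_ ?_
    · refine le_of_eq_of_le ?_ main
      refine sum_flip e' _ _ fun y => ?_
      have split : ∀ f : V → ℝ, ∏ v, f v = f e * f e' * ∏ v ∈ (univ.erase e).erase e', f v := by
        intro f
        rw [mul_assoc, Finset.mul_prod_erase _ _ (by simp [hne.symm]),
          Finset.mul_prod_erase _ _ (by simp)]
      have rest : ∀ b, ∏ v ∈ (univ.erase e).erase e',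
            T v (Function.update y e' b v) (Function.update y e' b (ρ v))
          = ∏ v ∈ (univ.erase e).erase e', T v (y v) (y (ρ v)) := by
        intro b
        refine Finset.prod_congr rfl fun v hv => ?_
        simp only [Finset.mem_erase, Finset.mem_univ, and_true] at hv
        have h3 : ρ v ≠ e' := by rw [← he]; exact fun h => hv.2 (ρ.injective h)
        rw [Function.update_of_ne hv.1, Function.update_of_ne h3]
      have rest' : ∀ b, ∏ v ∈ (univ.erase e).erase e',
            T' v (Function.update y e' b v) (Function.update y e' b (ρ' v))
          = ∏ v ∈ (univ.erase e).erase e', T v (y v) (y (ρ v)) := by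
        intro b
        rw [← rest b]
        refine Finset.prod_congr rfl fun v hv => ?_
        simp only [Finset.mem_erase, Finset.mem_univ, and_true] at hv
        rw [T'v v hv.2 hv.1, r3 v hv.2 hv.1]
      simp only [split, rest, rest', r1, r2, T'e, T'e', he]
      simp [Function.update_of_ne hne, Function.update_of_ne he', mulM]
      ring
    · intro v i j
      by_cases h1 : v = e
      · subst h1; rw [T'e]; unfold mulM
        have := T0 v; have := T0 e'
        exact add_nonneg (mul_nonneg (T0 _ _ _) (T0 _ _ _)) (mul_nonneg (T0 _ _ _) (T0 _ _ _))
      · by_cases h2 : v = e'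
        · subst h2; rw [T'e']; dsimp only; split_ifs <;> norm_num
        · rw [T'v v h1 h2]; exact T0 _ _ _
    · intro v hv
      by_cases h1 : v = e
      · subst h1; rw [T'e]
        exact GoodM.mul hr ht hy1 (T0 _) (T0 _) (TG _ hρe) (TG _ he')
      · by_cases h2 : v = e'
        · subst h2; exact absurd r2 hv
        · rw [T'v v h1 h2]; rw [r3 v h1 h2] at hv; exact TG _ hv
    · intro v hv
      by_cases h1 : v = e
      · subst h1; rw [T'e]
        exact GoodM.trace hr ht (T0 _) (T0 _) (TG _ hρe) (TG _ he')
      · by_cases h2 : v = e'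
        · subst h2; rw [T'e']; simp
        · rw [T'v v h1 h2]; rw [r3 v h1 h2] at hv; exact Tt _ hv

lemma lift_lift {n : ℕ} (π π' : Equiv.Perm (Fin n)) (e : Edge n) :
    lift π (lift π' e) = lift (π * π') e := by
  obtain ⟨⟨i, j⟩, hij⟩ := e
  have hne : π (π' i) ≠ π (π' j) := fun h => hij.ne (π'.injective (π.injective h))
  unfold lift
  apply Subtype.ext
  simp only [Equiv.Perm.mul_apply]
  rcases lt_or_gt_of_ne hne with h | h
  · by_cases h1 : π' i < π' j
    · simp [h1, h]
    · simp [h1, h, not_lt.mpr h.le]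
  · by_cases h1 : π' i < π' j
    · simp [h1, not_lt.mpr h.le]
    · simp [h1, h, not_lt.mpr h.le]

lemma lift_one {n : ℕ} (e : Edge n) : lift (1 : Equiv.Perm (Fin n)) e = e := by
  obtain ⟨⟨i, j⟩, hij⟩ := e
  have : i < j := hij
  unfold lift; simp [this]

/-- the edge permutation -/
def edgePerm {n : ℕ} (πs π : Equiv.Perm (Fin n)) : Equiv.Perm (Edge n) where
  toFun e := lift πs.symm (lift π e)
  invFun e := lift π.symm (lift πs e)
  left_inv e := by
    simp only [lift_lift]
    convert lift_one e using 2
    ext; simp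
  right_inv e := by
    simp only [lift_lift]
    convert lift_one e using 2
    ext; simp

lemma lift_symm_lift {n : ℕ} (π : Equiv.Perm (Fin n)) (e : Edge n) :
    lift π.symm (lift π e) = e := by
  rw [lift_lift]
  convert lift_one e using 2
  ext; simp

lemma lift_lift_symm {n : ℕ} (π : Equiv.Perm (Fin n)) (e : Edge n) :
    lift π (lift π.symm e) = e := by
  rw [lift_lift]
  convert lift_one e using 2
  ext; simp

lemma edgePerm_eq {n : ℕ} (πs π : Equiv.Perm (Fin n)) (e : Edge n) :
    lift π e = lift πs e ↔ edgePerm πs π e = e := by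
  change _ ↔ lift πs.symm (lift π e) = e
  constructor
  · intro h; rw [h, lift_symm_lift]
  · intro h; nth_rewrite 2 [← h]; rw [lift_lift_symm]

lemma tri {V : Type*} [Fintype V] [DecidableEq V] (f : V → Bool → Bool → Bool → ℝ) :
    ∑ ω : (V → Bool) × (V → Bool) × (V → Bool), ∏ e, f e (ω.1 e) (ω.2.1 e) (ω.2.2 e)
      = ∏ e, ∑ g, ∑ a, ∑ b, f e g a b := by
  simp only [Finset.prod_univ_sum, Fintype.piFinset_univ, Fintype.sum_prod_type]

/-- per-edge weight -/
noncomputable def Wt (P s u : ℝ) (mv : Prop) [Decidable mv] (g a b : Bool) : ℝ :=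
  bern P g * bern s a * bern s b * (if mv ∧ (g && a && b) = true then u else 1)

noncomputable def ka (c : ℝ) (mv : Prop) [Decidable mv] (j A : Bool) : ℝ :=
  if j then (if mv ∧ A = true then c else 0) else 1

noncomputable def kb (j B : Bool) : ℝ := if j then b2r B else 1

noncomputable def Tm (P s u c : ℝ) (mv : Prop) [Decidable mv] (i j : Bool) : ℝ :=
  ∑ g, ∑ a, ∑ b, Wt P s u mv g a b * ka c mv j (g && a) * kb i (g && b)

lemma link_expand {V : Type*} [Fintype V] [DecidableEq V] (ρ : Equiv.Perm V) (c : ℝ)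
    (A B : V → Bool) :
    ∏ e, (if ρ e ≠ e ∧ (A e && B (ρ e)) = true then 1 + c else 1)
      = ∑ y : V → Bool, ∏ e, ka c (ρ e ≠ e) (y (ρ e)) (A e) * kb (y e) (B e) := by
  have h1 : ∀ e, (if ρ e ≠ e ∧ (A e && B (ρ e)) = true then 1 + c else 1)
      = ∑ j, ka c (ρ e ≠ e) j (A e) * kb j (B (ρ e)) := by
    intro e
    by_cases h : ρ e = e <;> cases A e <;> cases B (ρ e) <;>
      simp [ka, kb, b2r, h, add_comm]
  simp_rw [h1]
  rw [Finset.prod_univ_sum, Fintype.piFinset_univ]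
  rw [← Equiv.sum_comp (Equiv.arrowCongr ρ.symm (Equiv.refl Bool))]
  refine Finset.sum_congr rfl fun y _ => ?_
  simp only [Finset.prod_mul_distrib]
  congr 1
  exact Equiv.prod_comp ρ (fun e => kb (y e) (B e))

lemma rpow_sum' {V : Type*} (x : ℝ) (hx : 0 < x) (s : Finset V) (f : V → ℝ) :
    x ^ (∑ e ∈ s, f e) = ∏ e ∈ s, x ^ f e := by
  classical
  induction s using Finset.induction_on with
  | empty => simp
  | insert a s ha ih => rw [Finset.sum_insert ha, Finset.prod_insert ha, Real.rpow_add hx, ih]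

lemma PGF_eq (n k : ℕ) (σ : Fin n → Fin k) (p q s : ℝ) (πs π : Equiv.Perm (Fin n))
    (θ w ζ : ℝ) (hθ : 0 < θ) (hw : 0 < w) (hζ : 0 < ζ) :
    PGF n k σ p q s πs π θ w ζ = ∑ y : Edge n → Bool, ∏ e : Edge n,
      Tm (if σ e.1.1 = σ e.1.2 then p else q) s
        (θ * (if σ e.1.1 = σ e.1.2 then w else ζ)) (1 / θ - 1)
        (edgePerm πs π e ≠ e) (y e) (y (edgePerm πs π e)) := by
  unfold Tm
  simp_rw [← tri]
  rw [Finset.sum_comm]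
  unfold PGF
  refine Finset.sum_congr rfl fun ω _ => ?_
  simp only [mul_assoc (Wt _ _ _ _ _ _ _)]
  simp_rw [Finset.prod_mul_distrib (f := fun e => Wt _ _ _ _ _ _ _)]
  rw [← Finset.mul_sum, ← link_expand (edgePerm πs π) (1 / θ - 1) (fun e => ω.1 e && ω.2.1 e)
    (fun e => ω.1 e && ω.2.2 e)]
  unfold condDensity Wt Xvar Yplus Yminus
  rw [rpow_sum' _ hθ, rpow_sum' _ hw, rpow_sum' _ hζ]
  simp only [Finset.prod_filter]
  simp only [← Finset.prod_mul_distrib]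
  refine Finset.prod_congr rfl fun e _ => ?_
  have hB : BvalC πs ω (lift πs e) = (ω.1 e && ω.2.2 e) := by
    simp [BvalC, lift_symm_lift]
  have hB' : BvalC πs ω (lift π e)
      = (ω.1 (edgePerm πs π e) && ω.2.2 (edgePerm πs π e)) := rfl
  have hA : AvalC ω e = (ω.1 e && ω.2.1 e) := rfl
  rw [hB, hB', hA]
  generalize (ω.1 (edgePerm πs π e) && ω.2.2 (edgePerm πs π e)) = B'
  simp only [ne_eq, edgePerm_eq]
  generalize ω.1 e = g
  generalize ω.2.1 e = a
  generalize ω.2.2 e = b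
  have h1 : θ ^ (-1 : ℝ) = 1 / θ := by rw [Real.rpow_neg_one, one_div]
  by_cases hm : edgePerm πs π e = e <;> by_cases hc : σ e.1.1 = σ e.1.2 <;>
    cases B' <;> cases g <;> cases a <;> cases b <;>
    simp [hm, hc, b2r, bern, h1] <;> field_simp

lemma PGF_zero (n k : ℕ) (σ : Fin n → Fin k) (s : ℝ) (πs π : Equiv.Perm (Fin n))
    (θ θ' w ζ : ℝ) : PGF n k σ 0 0 s πs π θ w ζ = PGF n k σ 0 0 s πs π θ' w ζ := by
  unfold PGF
  refine Finset.sum_congr rfl fun ω _ => ?_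
  by_cases h : ∃ e, ω.1 e = true
  · obtain ⟨e, he⟩ := h
    have : condDensity n k σ 0 0 s ω = 0 := by
      unfold condDensity
      rw [Finset.prod_eq_zero (Finset.mem_univ e)]
      · simp
      · simp [bern, he]
    simp [this]
  · push Not at h
    have hX : Xvar πs π ω = 0 := by
      unfold Xvar
      refine Finset.sum_eq_zero fun e _ => ?_
      simp [AvalC, h, b2r]
    simp [hX]

lemma Tm_fixed (P s u c : ℝ) (mv : Prop) [Decidable mv] (h : ¬ mv) :
    Tm P s u c mv false false + Tm P s u c mv true true = 1 := by
  simp [Tm, Wt, ka, kb, b2r, bern, h]; ring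

lemma Tm_nonneg (P s u c : ℝ) (mv : Prop) [Decidable mv] (hP : 0 ≤ P) (hP1 : P ≤ 1)
    (hs : 0 ≤ s) (hs1 : s ≤ 1) (hu : 0 ≤ u) (hc : 0 ≤ c) (i j : Bool) :
    0 ≤ Tm P s u c mv i j := by
  have hb : ∀ x b, 0 ≤ x → x ≤ 1 → 0 ≤ bern x b := by
    intro x b h0 h1; unfold bern; split_ifs <;> linarith
  unfold Tm
  refine Finset.sum_nonneg fun g _ => Finset.sum_nonneg fun a _ => Finset.sum_nonneg fun b _ => ?_
  refine mul_nonneg (mul_nonneg ?_ ?_) ?_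
  · unfold Wt
    refine mul_nonneg (mul_nonneg (mul_nonneg (hb _ _ hP hP1) (hb _ _ hs hs1)) (hb _ _ hs hs1)) ?_
    split_ifs <;> linarith
  · unfold ka; split_ifs <;> linarith
  · unfold kb b2r; split_ifs <;> norm_num

lemma Tm_moved (P s u c : ℝ) (mv : Prop) [Decidable mv] (h : mv) :
    Tm P s u c mv false false = 1 - s ^ 2 * P * (1 - u) ∧
    Tm P s u c mv false true = c * (s * P * (1 - s + s * u)) ∧
    Tm P s u c mv true false = s * P * (1 - s + s * u) ∧
    Tm P s u c mv true true = c * (s ^ 2 * P * u) := by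
  refine ⟨?_, ?_, ?_, ?_⟩ <;> simp [Tm, Wt, ka, kb, b2r, bern, h] <;> ring

set_option maxHeartbeats 2000000 in
lemma Tm_good (ε θ P s w L : ℝ) (mv : Prop) [Decidable mv] (h : mv)
    (hε : 0 < ε) (hε1 : ε < 1) (hθ : 0 < θ) (hθ1 : θ ≤ ε ^ 2 / 100)
    (hP : 0 ≤ P) (hP1 : P ≤ θ ^ 2) (hs : 0 ≤ s) (hs1 : s ≤ 1) (hw : 1 ≤ w) (hw3 : w ≤ 3)
    (hL : 1 - (1 - ε) * (s ^ 2 * P) ≤ L) (hL0 : 0 < L) :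
    GoodM (ε / 4 * s) (ε / 4 * s * θ) (fun i j => Tm P s (θ * w) (1 / θ - 1) mv i j / L) := by
  obtain ⟨e1, e2, e3, e4⟩ := Tm_moved P s (θ * w) (1 / θ - 1) mv h
  have hθs : θ ≤ 1 / 100 := by nlinarith
  have hεs : θ ≤ ε / 100 := by nlinarith
  set δ := s ^ 2 * P with hδ
  have hδ0 : 0 ≤ δ := by positivity
  have hδP : δ ≤ P := by
    have : s ^ 2 ≤ 1 := by nlinarith
    rw [hδ]; nlinarith
  have hδθ : δ ≤ θ ^ 2 := hδP.trans hP1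
  have hsP : 0 ≤ s * P := mul_nonneg hs hP
  have hL2 : 1 / 2 ≤ L := by nlinarith
  -- entry bounds
  have hu0 : 0 ≤ θ * w := by nlinarith
  have hu1 : θ * w ≤ 3 * θ := by nlinarith
  have hc0 : 0 ≤ 1 / θ - 1 := by
    rw [sub_nonneg, le_div_iff₀ hθ]; linarith
  have hbr0 : 0 ≤ 1 - s + s * (θ * w) := by nlinarith
  have hbr : 1 - s + s * (θ * w) ≤ 1 := by nlinarith
  have b1 : Tm P s (θ * w) (1 / θ - 1) mv false false ≤ 1 - δ + 3 * θ * δ := by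
    rw [e1]; nlinarith
  have b3 : Tm P s (θ * w) (1 / θ - 1) mv true false ≤ s * P := by
    rw [e3]; nlinarith
  have b2 : θ * Tm P s (θ * w) (1 / θ - 1) mv false true ≤ s * P := by
    rw [e2]
    have : θ * ((1 / θ - 1) * (s * P * (1 - s + s * (θ * w))))
      = (1 - θ) * (s * P * (1 - s + s * (θ * w))) := by field_simp
    rw [this]
    have h1 : s * P * (1 - s + s * (θ * w)) ≤ s * P := by nlinarith
    have h0 : 0 ≤ s * P * (1 - s + s * (θ * w)) := mul_nonneg hsP hbr0
    nlinarith
  have b4 : Tm P s (θ * w) (1 / θ - 1) mv true true ≤ 3 * δ := by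
    rw [e4]
    have : (1 / θ - 1) * (s ^ 2 * P * (θ * w)) = (1 - θ) * (δ * w) := by
      rw [hδ]; field_simp
    rw [this]
    have h1 : δ * w ≤ δ * 3 := by nlinarith
    have h0 : 0 ≤ δ * w := by positivity
    nlinarith
  have n2 : Tm P s (θ * w) (1 / θ - 1) mv false true ≤ s * θ := by
    have : θ * Tm P s (θ * w) (1 / θ - 1) mv false true ≤ θ * (s * θ) := by nlinarith
    exact le_of_mul_le_mul_left this hθ
  clear e1 e2 e3 e4
  generalize ha : Tm P s (θ * w) (1 / θ - 1) mv false false = a at *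
  generalize hb : Tm P s (θ * w) (1 / θ - 1) mv false true = b at *
  generalize hc : Tm P s (θ * w) (1 / θ - 1) mv true false = c at *
  generalize hd : Tm P s (θ * w) (1 / θ - 1) mv true true = d at *
  have w2 : d ≤ 3 * δ := b4
  have hεs0 : 0 ≤ ε * s := by positivity
  have hdδ : s ^ 2 * P = δ := hδ.symm
  have hss : s * s ≤ 1 := by nlinarith
  refine ⟨?_, ?_, ?_, ?_⟩ <;> simp only [ha, hb, hc, hd]
  · have : a / L + b / L * (ε / 4 * s * θ) + c / L * (ε / 4 * s)
        + ε / 4 * s * (ε / 4 * s * θ) * (d / L)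
        = (a + (ε / 4 * s) * (θ * b) + (ε / 4 * s) * c
          + (ε * s / 4) ^ 2 * θ * d) / L := by ring
    rw [this, div_le_one hL0]
    refine le_trans ?_ hL
    have v1 : (ε / 4 * s) * (θ * b) ≤ (ε / 4 * s) * (s * P) :=
      mul_le_mul_of_nonneg_left b2 (by positivity)
    have v2 : (ε / 4 * s) * c ≤ (ε / 4 * s) * (s * P) :=
      mul_le_mul_of_nonneg_left b3 (by positivity)
    have v3 : (ε * s / 4) ^ 2 * θ * d ≤ (ε * s / 4) ^ 2 * θ * (3 * δ) :=
      mul_le_mul_of_nonneg_left b4 (by positivity)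
    have v4 : (ε * s / 4) ^ 2 ≤ 1 := by
      have : ε * s ≤ 1 := by nlinarith
      nlinarith
    have v5 : (ε * s / 4) ^ 2 * (θ * (3 * δ)) ≤ 1 * (θ * (3 * δ)) :=
      mul_le_mul_of_nonneg_right v4 (by positivity)
    have v6 : (ε / 4 * s) * (s * P) = ε / 4 * δ := by rw [hδ]; ring
    have v7 : θ * δ ≤ ε / 100 * δ := mul_le_mul_of_nonneg_right hεs hδ0
    have v8 : 0 ≤ ε * δ := by positivity
    linarith
  · have : b / L + ε / 4 * s * (d / L) = (b + ε / 4 * s * d) / L := by ring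
    rw [this, div_le_iff₀ hL0]
    have v1 : ε / 4 * s * d ≤ ε / 4 * s * (3 / 100) :=
      mul_le_mul_of_nonneg_left (by nlinarith) (by positivity)
    have v2 : s * θ ≤ s * (ε / 100) := mul_le_mul_of_nonneg_left hεs hs
    have v3 : ε / 4 * s * (1 / 2) ≤ ε / 4 * s * L := mul_le_mul_of_nonneg_left hL2 (by positivity)
    linarith
  · have : c / L + ε / 4 * s * θ * (d / L) = (c + ε / 4 * s * θ * d) / L := by ring
    rw [this, div_le_iff₀ hL0]
    have z : 0 ≤ ε / 4 * s * θ := by positivity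
    have v1 : ε / 4 * s * θ * d ≤ ε / 4 * s * θ * (3 / 100) :=
      mul_le_mul_of_nonneg_left (by nlinarith) z
    have v2 : s * P ≤ s * (ε / 100 * θ) := mul_le_mul_of_nonneg_left (by nlinarith) hs
    have v3 : ε / 4 * s * θ * (1 / 2) ≤ ε / 4 * s * θ * L := mul_le_mul_of_nonneg_left hL2 z
    linarith
  · rw [div_le_iff₀ hL0]
    have v0 : P ≤ θ * (ε ^ 2 / 100) := by nlinarith
    have v1 : s ^ 2 * P ≤ s ^ 2 * (θ * (ε ^ 2 / 100)) :=
      mul_le_mul_of_nonneg_left v0 (by positivity)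
    have z : 0 ≤ ε / 4 * s * (ε / 4 * s * θ) := by positivity
    have v3 := mul_le_mul_of_nonneg_left hL2 z
    have z2 : 0 ≤ s ^ 2 * θ * ε ^ 2 := by positivity
    linarith

lemma PGF_main (n k : ℕ) (σ : Fin n → Fin k) (p q s : ℝ) (πs π : Equiv.Perm (Fin n))
    (ε θ w ζ : ℝ) (hε : 0 < ε) (hε1 : ε < 1) (hθ : 0 < θ) (hθ1 : θ ≤ ε ^ 2 / 100)
    (hp : 0 ≤ p) (hp1 : p ≤ θ ^ 2) (hq : 0 ≤ q) (hq1 : q ≤ θ ^ 2)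
    (hs : 0 ≤ s) (hs1 : s ≤ 1) (hw : 1 ≤ w) (hw3 : w ≤ 3) (hz : 1 ≤ ζ) (hz3 : ζ ≤ 3) :
    PGF n k σ p q s πs π θ w ζ
      ≤ Real.exp (-(1 - ε) * s ^ 2 * (p * Mplus σ πs π + q * Mminus σ πs π)) := by
  rw [PGF_eq _ _ _ _ _ _ _ _ _ _ _ hθ (by linarith) (by linarith)]
  set ρ := edgePerm πs π with hρ
  set P : Edge n → ℝ := fun e => if σ e.1.1 = σ e.1.2 then p else q with hPdef
  set W : Edge n → ℝ := fun e => if σ e.1.1 = σ e.1.2 then w else ζ with hWdef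
  have hP0 : ∀ e, 0 ≤ P e := by intro e; simp only [hPdef]; split_ifs <;> assumption
  have hP1 : ∀ e, P e ≤ θ ^ 2 := by intro e; simp only [hPdef]; split_ifs <;> assumption
  have hW0 : ∀ e, 1 ≤ W e := by intro e; simp only [hWdef]; split_ifs <;> assumption
  have hW1 : ∀ e, W e ≤ 3 := by intro e; simp only [hWdef]; split_ifs <;> assumption
  have hθs : θ ≤ 1 / 100 := by nlinarith
  set x : Edge n → ℝ := fun e => if ρ e ≠ e then -(1 - ε) * s ^ 2 * P e else 0 with hx
  have hexp : -(1 - ε) * s ^ 2 * (p * Mplus σ πs π + q * Mminus σ πs π) = ∑ e, x e := by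
    simp only [Mplus, Mminus, Finset.card_filter, Nat.cast_sum, Finset.mul_sum,
      ← Finset.sum_add_distrib]
    refine Finset.sum_congr rfl fun e _ => ?_
    simp only [hx, hPdef, ne_eq, edgePerm_eq, ← hρ]
    by_cases hm : ρ e = e <;> by_cases hc : σ e.1.1 = σ e.1.2 <;> simp [hm, hc]
  rw [hexp, Real.exp_sum]
  have hc0 : 0 ≤ 1 / θ - 1 := by
    rw [sub_nonneg, le_div_iff₀ hθ]; linarith
  have key := Z_bound (V := Edge n) (r := ε / 4 * s) (t := ε / 4 * s * θ) (by positivity)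
    (by positivity) (by
      have h1 : ε / 4 * s ≤ 1 := by nlinarith
      have h0 : 0 ≤ ε / 4 * s := by positivity
      have h2 : ε / 4 * s * θ ≤ 1 := by nlinarith
      exact mul_le_one₀ h1 (by positivity) h2) _ ρ rfl
    (fun e i j => Tm (P e) s (θ * W e) (1 / θ - 1) (ρ e ≠ e) i j / Real.exp (x e))
    (fun e i j => div_nonneg (Tm_nonneg _ _ _ _ _ (hP0 e) (by nlinarith [hP1 e]) hs hs1
      (by nlinarith [hW0 e]) hc0 _ _) (Real.exp_pos _).le)
    (fun e he => Tm_good ε θ (P e) s (W e) (Real.exp (x e)) _ he hε hε1 hθ hθ1 (hP0 e) (hP1 e)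
      hs hs1 (hW0 e) (hW1 e) (by
        have := Real.add_one_le_exp (x e)
        simp only [hx, if_pos he] at this ⊢
        linarith) (Real.exp_pos _))
    (fun e he => by
      have h0 : x e = 0 := by simp [hx, he]
      rw [h0]
      have := Tm_fixed (P e) s (θ * W e) (1 / θ - 1) (ρ e ≠ e) (by simp [he])
      simp only [Real.exp_zero, div_one]
      exact this.le)
  simp only [Finset.prod_div_distrib] at key
  rw [← Finset.sum_div, div_le_one (Finset.prod_pos fun e _ => Real.exp_pos _)] at key
  exact key

/-- PGF bound, Lemma `lem:PGF`.
With `p, q = o(1)`, `θ = max(√p,√q)`, for any `ε ∈ (0,1)` and `1 ≤ ω, ζ ≤ 3`, for all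
sufficiently large `n` and all `σ`, `π⋆`, `π`:
`E[θ^{X(τ)} ω^{Y⁺(τ)} ζ^{Y⁻(τ)}] ≤ exp(-(1-ε) s² (p M⁺(τ) + q M⁻(τ)))`. -/
theorem pgf_bound
    (p q s : ℕ → ℝ)
    (hp01 : ∀ n, p n ∈ Set.Icc (0 : ℝ) 1) (hq01 : ∀ n, q n ∈ Set.Icc (0 : ℝ) 1)
    (hs01 : ∀ n, s n ∈ Set.Icc (0 : ℝ) 1)
    (hp : Tendsto p atTop (nhds 0)) (hq : Tendsto q atTop (nhds 0)) :
    ∀ ε ∈ Set.Ioo (0 : ℝ) 1, ∀ w ∈ Set.Icc (1 : ℝ) 3, ∀ ζ ∈ Set.Icc (1 : ℝ) 3,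
      ∃ N : ℕ, ∀ n ≥ N, ∀ (k : ℕ) (σ : Fin n → Fin k) (πstar π : Equiv.Perm (Fin n)),
        PGF n k σ (p n) (q n) (s n) πstar π
            (max (Real.sqrt (p n)) (Real.sqrt (q n))) w ζ
          ≤ Real.exp (-(1 - ε) * s n ^ 2
              * (p n * Mplus σ πstar π + q n * Mminus σ πstar π)) := by
  intro ε hε w hw ζ hζ
  have hθ0 : (0 : ℝ) < ε ^ 2 / 100 := by have := hε.1; positivity
  have hev : ∀ u : ℕ → ℝ, Tendsto u atTop (nhds 0) →
      ∀ᶠ n in atTop, u n ≤ (ε ^ 2 / 100) ^ 2 := by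
    intro u hu
    exact (hu.eventually (gt_mem_nhds (show (0 : ℝ) < (ε ^ 2 / 100) ^ 2 by positivity))).mono
      fun n hn => le_of_lt hn
  obtain ⟨N, hN⟩ := ((hev p hp).and (hev q hq)).exists_forall_of_atTop
  refine ⟨N, fun n hn k σ πstar π => ?_⟩
  obtain ⟨h1, h2⟩ := hN n hn
  obtain ⟨hp0, -⟩ := hp01 n
  obtain ⟨hq0, -⟩ := hq01 n
  obtain ⟨hs0, hs1⟩ := hs01 n
  rcases (le_max_of_le_left (Real.sqrt_nonneg (p n)) :
    0 ≤ max (Real.sqrt (p n)) (Real.sqrt (q n))).eq_or_lt with h | h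
  · have hp' : p n = 0 := by
      have := le_max_left (Real.sqrt (p n)) (Real.sqrt (q n))
      rw [← h] at this
      exact (Real.sqrt_eq_zero hp0).1 (le_antisymm this (Real.sqrt_nonneg _))
    have hq' : q n = 0 := by
      have := le_max_right (Real.sqrt (p n)) (Real.sqrt (q n))
      rw [← h] at this
      exact (Real.sqrt_eq_zero hq0).1 (le_antisymm this (Real.sqrt_nonneg _))
    rw [hp', hq', PGF_zero n k σ (s n) πstar π _ (ε ^ 2 / 100) w ζ]
    exact PGF_main n k σ 0 0 (s n) πstar π ε _ w ζ hε.1 hε.2 hθ0 le_rfl le_rfl (by positivity)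
      le_rfl (by positivity) hs0 hs1 hw.1 hw.2 hζ.1 hζ.2
  · refine PGF_main n k σ _ _ (s n) πstar π ε _ w ζ hε.1 hε.2 h ?_ hp0 ?_
      hq0 ?_ hs0 hs1 hw.1 hw.2 hζ.1 hζ.2
    · exact max_le (Real.sqrt_le_iff.2 ⟨hθ0.le, h1⟩) (Real.sqrt_le_iff.2 ⟨hθ0.le, h2⟩)
    · exact (Real.sqrt_le_left h.le).1 (le_max_left _ _)
    · exact (Real.sqrt_le_left h.le).1 (le_max_right _ _)

end CSBM
end

section
/- Let σ : [n] → [k] be a labeling with V_r = σ^{-1}(r), let π_* and π be permutations of [n] with lifted permutations τ_* = ℓ(π_*) and τ = ℓ(π), and let x_r = |{i ∈ V_r : π(i) ≠ π_*(i)}| for r ∈ [k]. Then M⁺(τ) = Σ_{r=1}^k [ C(x_r,2) + x_r·(|V_r| − x_r) ] − |E_tr⁺| and M⁻(τ) = Σ_{r=1}^k x_r·(n − |V_r|) − Σ_{r<r'} x_r·x_{r'} − |E_tr⁻|. Moreover |E_tr⁺| ≤ (x_1 + ⋯ + x_k)/2 and |E_tr⁻| ≤ (x_1 + ⋯ + x_k)/2.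 -/
open Finset Filter

namespace CSBM

/-- `|E_tr⁺|`: number of intra-community transposed pairs. -/
def EtrPlus {n k : ℕ} (σ : Fin n → Fin k) (πstar π : Equiv.Perm (Fin n)) : ℕ :=
  (univ.filter fun e : Edge n =>
    σ e.1.1 = σ e.1.2 ∧ π e.1.1 = πstar e.1.2 ∧ π e.1.2 = πstar e.1.1).card

/-- `|E_tr⁻|`: number of inter-community transposed pairs. -/
def EtrMinus {n k : ℕ} (σ : Fin n → Fin k) (πstar π : Equiv.Perm (Fin n)) : ℕ :=
  (univ.filter fun e : Edge n =>
    σ e.1.1 ≠ σ e.1.2 ∧ π e.1.1 = πstar e.1.2 ∧ π e.1.2 = πstar e.1.1).card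


theorem sum_lt_symm {m : ℕ} (f : Fin m → Fin m → ℤ) (hf : ∀ u v, f u v = f v u) :
    2 * ∑ e ∈ univ.filter (fun e : Fin m × Fin m => e.1 < e.2), f e.1 e.2
      = (∑ u, ∑ v, f u v) - ∑ u, f u u := by
  have h1 : ∑ e ∈ univ.filter (fun e : Fin m × Fin m => e.1 < e.2), f e.1 e.2
      = ∑ u, ∑ v, if u < v then f u v else 0 := by
    rw [sum_filter, Fintype.sum_prod_type]
  have h2 : (∑ u : Fin m, ∑ v, if u < v then f u v else 0)
      = ∑ u : Fin m, ∑ v, if v < u then f u v else 0 := by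
    rw [sum_comm]
    refine sum_congr rfl fun u _ => sum_congr rfl fun v _ => ?_
    rw [hf]
  have h3 : ∑ u, f u u = ∑ u : Fin m, ∑ v, if u = v then f u v else 0 := by
    simp
  rw [two_mul, h1]
  nth_rewrite 2 [h2]
  rw [h3, ← sum_add_distrib, ← sum_sub_distrib]
  refine sum_congr rfl fun u _ => ?_
  rw [← sum_add_distrib, ← sum_sub_distrib]
  refine sum_congr rfl fun v _ => ?_
  rcases lt_trichotomy u v with h | h | h
  · simp [h, h.ne, h.not_gt]
  · simp [h]
  · simp [h, h.ne', h.not_gt]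

theorem sum_edge {n : ℕ} (f : Fin n → Fin n → ℤ) :
    ∑ e : Edge n, f e.1.1 e.1.2
      = ∑ e ∈ univ.filter (fun e : Fin n × Fin n => e.1 < e.2), f e.1 e.2 := by
  symm
  exact sum_subtype _ (by simp) (fun e : Fin n × Fin n => f e.1 e.2)

theorem sum_edge_symm {n : ℕ} (f : Fin n → Fin n → ℤ) (hf : ∀ u v, f u v = f v u) :
    2 * ∑ e : Edge n, f e.1.1 e.1.2 = (∑ u, ∑ v, f u v) - ∑ u, f u u := by
  rw [sum_edge, sum_lt_symm f hf]

/-- mismatch indicator -/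
def dd {n : ℕ} (πstar π : Equiv.Perm (Fin n)) (i : Fin n) : ℤ := if π i ≠ πstar i then 1 else 0

/-- class indicator -/
def cc {n k : ℕ} (σ : Fin n → Fin k) (i j : Fin n) : ℤ := if σ i = σ j then 1 else 0

theorem lift_ne_iff {n : ℕ} (πstar π : Equiv.Perm (Fin n)) (e : Edge n) :
    lift π e ≠ lift πstar e ↔ (π e.1.1 ≠ πstar e.1.1 ∨ π e.1.2 ≠ πstar e.1.2) ∧
      ¬ (π e.1.1 = πstar e.1.2 ∧ π e.1.2 = πstar e.1.1) := by
  obtain ⟨⟨u, v⟩, h⟩ := e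
  have h1 : π u ≠ π v := fun hc => h.ne (π.injective hc)
  have h2 : πstar u ≠ πstar v := fun hc => h.ne (πstar.injective hc)
  simp only [lift]
  split_ifs <;> simp only [ne_eq, Subtype.mk.injEq, Prod.mk.injEq] <;> grind

theorem edge_point {n : ℕ} (πstar π : Equiv.Perm (Fin n)) (e : Edge n) :
    ((if lift π e ≠ lift πstar e then 1 else 0 : ℤ)
      + if (π e.1.1 = πstar e.1.2 ∧ π e.1.2 = πstar e.1.1) then 1 else 0)
      = dd πstar π e.1.1 + dd πstar π e.1.2 - dd πstar π e.1.1 * dd πstar π e.1.2 := by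
  have hl := lift_ne_iff πstar π e
  have h := e.2.ne
  have h1 : π e.1.1 ≠ π e.1.2 := fun hc => h (π.injective hc)
  simp only [hl, dd]
  split_ifs <;> grind

theorem sum_cc {n k : ℕ} (σ : Fin n → Fin k) (g h : Fin n → ℤ) :
    ∑ u, ∑ v, cc σ u v * (g u * h v)
      = ∑ r, (∑ u, if σ u = r then g u else 0) * (∑ v, if σ v = r then h v else 0) := by
  simp_rw [sum_mul_sum]
  rw [sum_comm]
  conv_rhs => rw [sum_comm]
  rw [sum_comm]
  refine sum_congr rfl fun u _ => ?_
  rw [sum_comm]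
  refine sum_congr rfl fun v _ => ?_
  have : ∀ r, ((if σ u = r then g u else 0) * if σ v = r then h v else 0)
      = if σ u = r then cc σ u v * (g u * h v) else 0 := by
    intro r
    simp only [cc]
    split_ifs <;> grind
  simp [this]

theorem xcount_eq {n k : ℕ} (σ : Fin n → Fin k) (πstar π : Equiv.Perm (Fin n)) (r : Fin k) :
    (∑ u, if σ u = r then dd πstar π u else 0) = (xcount σ πstar π r : ℤ) := by
  simp only [xcount, card_filter, Nat.cast_sum, dd]
  refine sum_congr rfl fun u _ => ?_
  split_ifs <;> simp_all

theorem Vcard_eq {n k : ℕ} (σ : Fin n → Fin k) (r : Fin k) :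
    (∑ u, if σ u = r then (1 : ℤ) else 0) = (Vcard σ r : ℤ) := by
  simp [Vcard]

theorem sum_xcount {n k : ℕ} (σ : Fin n → Fin k) (πstar π : Equiv.Perm (Fin n)) :
    ∑ r, (xcount σ πstar π r : ℤ) = ∑ u, dd πstar π u := by
  simp_rw [← xcount_eq]
  rw [sum_comm]
  simp

theorem plus_edge {n k : ℕ} (σ : Fin n → Fin k) (πstar π : Equiv.Perm (Fin n)) :
    (Mplus σ πstar π : ℤ) + EtrPlus σ πstar π = ∑ e : Edge n, cc σ e.1.1 e.1.2 *
      (dd πstar π e.1.1 + dd πstar π e.1.2 - dd πstar π e.1.1 * dd πstar π e.1.2) := by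
  simp only [Mplus, EtrPlus, card_filter, Nat.cast_sum]
  rw [← sum_add_distrib]
  refine sum_congr rfl fun e _ => ?_
  rw [← edge_point]
  by_cases h : σ e.1.1 = σ e.1.2 <;> simp [h, cc]

theorem minus_edge {n k : ℕ} (σ : Fin n → Fin k) (πstar π : Equiv.Perm (Fin n)) :
    (Mminus σ πstar π : ℤ) + EtrMinus σ πstar π = ∑ e : Edge n, (1 - cc σ e.1.1 e.1.2) *
      (dd πstar π e.1.1 + dd πstar π e.1.2 - dd πstar π e.1.1 * dd πstar π e.1.2) := by
  simp only [Mminus, EtrMinus, card_filter, Nat.cast_sum]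
  rw [← sum_add_distrib]
  refine sum_congr rfl fun e _ => ?_
  rw [← edge_point]
  by_cases h : σ e.1.1 = σ e.1.2 <;> simp [h, cc]

theorem cc_comm {n k : ℕ} (σ : Fin n → Fin k) (u v : Fin n) : cc σ u v = cc σ v u := by
  simp only [cc, eq_comm]

theorem sum_cc_full {n k : ℕ} (σ : Fin n → Fin k) (πstar π : Equiv.Perm (Fin n)) :
    ∑ u, ∑ v, cc σ u v * (dd πstar π u + dd πstar π v - dd πstar π u * dd πstar π v)
     = ∑ r, (2 * (xcount σ πstar π r : ℤ) * Vcard σ r - (xcount σ πstar π r : ℤ) ^ 2) := by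
  have e1 := sum_cc σ (dd πstar π) (fun _ => 1)
  have e2 := sum_cc σ (fun _ => 1) (dd πstar π)
  have e3 := sum_cc σ (dd πstar π) (dd πstar π)
  simp only [xcount_eq, Vcard_eq] at e1 e2 e3
  have : ∀ u v, cc σ u v * (dd πstar π u + dd πstar π v - dd πstar π u * dd πstar π v)
      = cc σ u v * (dd πstar π u * 1) + cc σ u v * (1 * dd πstar π v)
        - cc σ u v * (dd πstar π u * dd πstar π v) := by intros; ring
  simp only [this, sum_sub_distrib, sum_add_distrib, e1, e2, e3]
  rw [← sum_add_distrib, ← sum_sub_distrib, ← sum_sub_distrib]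
  refine sum_congr rfl fun r _ => ?_
  ring

theorem dd_sq {n : ℕ} (πstar π : Equiv.Perm (Fin n)) (u : Fin n) :
    dd πstar π u * dd πstar π u = dd πstar π u := by
  simp only [dd]; split_ifs <;> simp

theorem choose_two_int (x : ℕ) : 2 * ((x.choose 2 : ℕ) : ℤ) = (x : ℤ) ^ 2 - x := by
  induction x with
  | zero => simp
  | succ m ih =>
    rw [Nat.choose_succ_succ' m 1]
    push_cast
    rw [mul_add, ih]
    simp
    ring

theorem etr_bound {n : ℕ} (πstar π : Equiv.Perm (Fin n)) (q : Fin n → Fin n → Prop)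
    [∀ u v, Decidable (q u v)] (hq : ∀ u v, q u v ↔ q v u) :
    2 * (((univ.filter fun e : Edge n =>
      q e.1.1 e.1.2 ∧ π e.1.1 = πstar e.1.2 ∧ π e.1.2 = πstar e.1.1).card : ℕ) : ℤ)
      ≤ ∑ u, dd πstar π u := by
  have key := sum_edge_symm (n := n)
    (fun u v => if u ≠ v ∧ q u v ∧ π u = πstar v ∧ π v = πstar u then 1 else 0)
    (by intro u v; have := hq u v; congr 1; grind)
  have h0 : (((univ.filter fun e : Edge n =>
      q e.1.1 e.1.2 ∧ π e.1.1 = πstar e.1.2 ∧ π e.1.2 = πstar e.1.1).card : ℕ) : ℤ)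
      = ∑ e : Edge n, if e.1.1 ≠ e.1.2 ∧ q e.1.1 e.1.2 ∧ π e.1.1 = πstar e.1.2 ∧
        π e.1.2 = πstar e.1.1 then 1 else 0 := by
    rw [card_filter, Nat.cast_sum]
    refine sum_congr rfl fun e _ => ?_
    simp [e.2.ne]
  rw [h0, key]
  simp only [ne_eq, not_true_eq_false, false_and, if_false, sum_const_zero, sub_zero]
  refine sum_le_sum fun u _ => ?_
  calc _ ≤ ∑ v, if v = πstar.symm (π u) then dd πstar π u else 0 := by
        refine sum_le_sum fun v _ => ?_
        by_cases hv : v = πstar.symm (π u)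
        · have : πstar v = π u := by simp [hv]
          have hi : πstar u = πstar v → u = v := fun h => πstar.injective h
          rw [if_pos hv]
          simp only [dd]
          split_ifs <;> grind
        · rw [if_neg hv, if_neg]
          rintro ⟨-, -, h, -⟩
          exact hv (by simp [h])
    _ = _ := by simp

/-- Lemma `lem:M`: exact expressions for `M⁺(τ)` and `M⁻(τ)`.
`M⁺(τ) = Σ_r [C(x_r,2) + x_r(|V_r|-x_r)] - |E_tr⁺|`,
`M⁻(τ) = Σ_r x_r(n-|V_r|) - Σ_{r<r'} x_r x_{r'} - |E_tr⁻|`, and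
`|E_tr⁺|, |E_tr⁻| ≤ (x_1+⋯+x_k)/2`. -/
theorem M_identities (n k : ℕ) (σ : Fin n → Fin k) (πstar π : Equiv.Perm (Fin n)) :
    ((Mplus σ πstar π : ℤ) =
        (∑ r : Fin k, (((xcount σ πstar π r).choose 2 : ℤ)
          + (xcount σ πstar π r : ℤ) * ((Vcard σ r : ℤ) - (xcount σ πstar π r : ℤ))))
          - (EtrPlus σ πstar π : ℤ)) ∧
    ((Mminus σ πstar π : ℤ) =
        (∑ r : Fin k, (xcount σ πstar π r : ℤ) * ((n : ℤ) - (Vcard σ r : ℤ)))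
          - (∑ e ∈ univ.filter (fun e : Fin k × Fin k => e.1 < e.2),
              (xcount σ πstar π e.1 : ℤ) * (xcount σ πstar π e.2 : ℤ))
          - (EtrMinus σ πstar π : ℤ)) ∧
    ((EtrPlus σ πstar π : ℝ) ≤ (∑ r : Fin k, (xcount σ πstar π r : ℝ)) / 2) ∧
    ((EtrMinus σ πstar π : ℝ) ≤ (∑ r : Fin k, (xcount σ πstar π r : ℝ)) / 2) := by
  have hX := sum_xcount σ πstar π
  have hfull := sum_cc_full σ πstar π
  refine ⟨?_, ?_, ?_, ?_⟩
  · have h1 := plus_edge σ πstar π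
    have h2 := sum_edge_symm (fun u v => cc σ u v *
      (dd πstar π u + dd πstar π v - dd πstar π u * dd πstar π v))
      (by intro u v; simp only [cc_comm σ u v]; ring)
    simp only [hfull, dd_sq] at h2
    have h3 : ∑ u, cc σ u u * (dd πstar π u + dd πstar π u - dd πstar π u)
        = ∑ u, dd πstar π u := by simp [cc]
    rw [h3, ← hX, ← sum_sub_distrib, ← h1] at h2
    have h4 : 2 * (∑ r : Fin k, (((xcount σ πstar π r).choose 2 : ℤ)
          + (xcount σ πstar π r : ℤ) * ((Vcard σ r : ℤ) - (xcount σ πstar π r : ℤ))))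
        = ∑ r, (2 * (xcount σ πstar π r : ℤ) * Vcard σ r - (xcount σ πstar π r : ℤ) ^ 2
          - xcount σ πstar π r) := by
      rw [mul_sum]
      refine sum_congr rfl fun r _ => ?_
      rw [mul_add, choose_two_int]
      ring
    linarith
  · have h1 := minus_edge σ πstar π
    have h2 := sum_edge_symm (fun u v => (1 - cc σ u v) *
      (dd πstar π u + dd πstar π v - dd πstar π u * dd πstar π v))
      (by intro u v; simp only [cc_comm σ u v]; ring)
    have h3 : ∑ u, (1 - cc σ u u) * (dd πstar π u + dd πstar π u - dd πstar π u * dd πstar π u)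
        = 0 := by simp [cc]
    have h5 : ∑ u, ∑ v, (dd πstar π u + dd πstar π v - dd πstar π u * dd πstar π v)
        = 2 * n * (∑ u, dd πstar π u) - (∑ u, dd πstar π u) ^ 2 := by
      rw [sq, sum_mul_sum]
      simp only [sum_sub_distrib, sum_add_distrib, sum_const, card_univ, Fintype.card_fin,
        nsmul_eq_mul, ← mul_sum]
      ring
    have h6 := sum_lt_symm (fun r r' => (xcount σ πstar π r : ℤ) * (xcount σ πstar π r' : ℤ))
      (by intros; ring)
    rw [← sum_mul_sum, hX] at h6
    simp only [sub_mul, one_mul, sum_sub_distrib, hfull, ← sq] at h2 h3 h6 h5 h1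
    simp only [mul_sub, sum_sub_distrib, ← sum_mul, hX]
    have h7 : ∑ r, 2 * (xcount σ πstar π r : ℤ) * Vcard σ r
        = 2 * ∑ r, (xcount σ πstar π r : ℤ) * Vcard σ r := by
      rw [mul_sum]
      exact sum_congr rfl fun r _ => by ring
    linarith
  · have h := etr_bound πstar π (fun u v => σ u = σ v) (fun u v => eq_comm)
    rw [← hX] at h
    have h' : (2 * (EtrPlus σ πstar π : ℝ)) ≤ ∑ r : Fin k, (xcount σ πstar π r : ℝ) := by
      exact_mod_cast h
    linarith
  · have h := etr_bound πstar π (fun u v => σ u ≠ σ v) (fun u v => ne_comm)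
    rw [← hX] at h
    have h' : (2 * (EtrMinus σ πstar π : ℝ)) ≤ ∑ r : Fin k, (xcount σ πstar π r : ℝ) := by
      exact_mod_cast h
    linarith

end CSBM
end

section
/- In the correlated stochastic block model, let p = o(1), q = o(1), s ∈ [0,1] and ε ∈ (0,1) satisfy n·p·s² = ω(1), n·q·s² = ω(1), and n·s²·(p+(k−1)q)/k > (1+ε)·(1−ε)^{−2}·log n. Then there exists a positive constant C with the following property: for every community labeling σ satisfying the balancedness event F_ε, every ground-truth permutation π_* (τ_* = ℓ(π_*)), and all nonnegative integers x_1,…,x_k with x_r ≥ (ε/2)·|V_r| for at least one r ∈ [k], for all sufficiently large n, if k ≤ C·min(√(n·p·s²), n·q·s²) then P(τ̂ ∈ S_{x_1,…,x_k} | σ, τ_*) ≤ n^{−δ·(x_1+⋯+x_k)}, where δ = min( ε/2, ε²(1−ε)·n·p·s²/(100·k·log n), ε²(k−1)·n·q·s²/(100·k·log n) ). -/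
open Finset Filter

namespace CSBM

section Generic
set_option linter.unusedSectionVars false
variable {ι : Type*} [Fintype ι] [DecidableEq ι]

/-- real value of a Boolean -/
def bi (b : Bool) : ℝ := if b then 1 else 0

/-- weight -/
noncomputable def W (P : ι → ℝ) (s : ℝ) (ω : (ι → Bool) × (ι → Bool) × (ι → Bool)) : ℝ :=
  (∏ e, bern (P e) (ω.1 e)) * (∏ e, bern s (ω.2.1 e)) * (∏ e, bern s (ω.2.2 e))

/-- expectation -/
noncomputable def Ex (P : ι → ℝ) (s : ℝ) (F : (ι → Bool) × (ι → Bool) × (ι → Bool) → ℝ) : ℝ :=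
  ∑ ω, W P s ω * F ω

lemma bern_nonneg {p : ℝ} (h0 : 0 ≤ p) (h1 : p ≤ 1) (b : Bool) : 0 ≤ bern p b := by
  unfold bern; split_ifs <;> linarith

lemma W_nonneg {P : ι → ℝ} {s : ℝ} (hP0 : ∀ e, 0 ≤ P e) (hP1 : ∀ e, P e ≤ 1) (hs0 : 0 ≤ s)
    (hs1 : s ≤ 1) (ω) : 0 ≤ W P s ω := by
  unfold W
  refine mul_nonneg (mul_nonneg ?_ ?_) ?_ <;> refine Finset.prod_nonneg fun e _ => bern_nonneg ?_ ?_ _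
  all_goals first | assumption | exact hP0 e | exact hP1 e

lemma Ex_mono {P : ι → ℝ} {s : ℝ} (hP0 : ∀ e, 0 ≤ P e) (hP1 : ∀ e, P e ≤ 1) (hs0 : 0 ≤ s)
    (hs1 : s ≤ 1) {F F' : (ι → Bool) × (ι → Bool) × (ι → Bool) → ℝ} (h : ∀ ω, F ω ≤ F' ω) :
    Ex P s F ≤ Ex P s F' :=
  Finset.sum_le_sum fun ω _ => mul_le_mul_of_nonneg_left (h ω) (W_nonneg hP0 hP1 hs0 hs1 ω)

lemma Ex_prod (P : ι → ℝ) (s : ℝ) (h : ι → Bool → Bool → Bool → ℝ) :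
    Ex P s (fun ω => ∏ e, h e (ω.1 e) (ω.2.1 e) (ω.2.2 e))
      = ∏ e, ∑ a, ∑ b, ∑ c, bern (P e) a * bern s b * bern s c * h e a b c := by
  unfold Ex W
  simp only [Fintype.sum_prod_type, ← Finset.prod_mul_distrib]
  rw [Fintype.prod_sum]
  refine Finset.sum_congr rfl fun x _ => ?_
  rw [Fintype.prod_sum]
  refine Finset.sum_congr rfl fun y _ => ?_
  rw [Fintype.prod_sum]

lemma Ex_one (P : ι → ℝ) (s : ℝ) : Ex P s (fun _ => 1) = 1 := by
  have := Ex_prod P s (fun _ _ _ _ => 1)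
  simp only [Finset.prod_const_one] at this
  rw [this]
  refine Finset.prod_eq_one fun e _ => ?_
  simp [bern]; ring

lemma Ex_sum {κ : Type*} (t : Finset κ) (P : ι → ℝ) (s : ℝ)
    (F : κ → (ι → Bool) × (ι → Bool) × (ι → Bool) → ℝ) :
    Ex P s (fun ω => ∑ i ∈ t, F i ω) = ∑ i ∈ t, Ex P s (F i) := by
  unfold Ex
  rw [Finset.sum_comm]
  simp only [Finset.mul_sum]

lemma Ex_smul (c : ℝ) (P : ι → ℝ) (s : ℝ)
    (F : (ι → Bool) × (ι → Bool) × (ι → Bool) → ℝ) :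
    Ex P s (fun ω => c * F ω) = c * Ex P s F := by
  unfold Ex
  rw [Finset.mul_sum]
  exact Finset.sum_congr rfl fun _ _ => by ring

/-- the true alignment on `T` -/
noncomputable def DD (T : Finset ι) (ω : (ι → Bool) × (ι → Bool) × (ι → Bool)) : ℝ :=
  ∑ e ∈ T, bi (ω.1 e && ω.2.1 e) * bi (ω.1 e && ω.2.2 e)

/-- the alignment along `τ` -/
noncomputable def ZZ (τ : ι → ι) (T : Finset ι) (ω : (ι → Bool) × (ι → Bool) × (ι → Bool)) : ℝ :=
  ∑ e ∈ T, bi (ω.1 e && ω.2.1 e) * bi (ω.1 (τ e) && ω.2.2 (τ e))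

lemma Ex_DD {P : ι → ℝ} {s : ℝ} (hP0 : ∀ e, 0 ≤ P e) (hP1 : ∀ e, P e ≤ 1) (hs0 : 0 ≤ s)
    (hs1 : s ≤ 1) (T : Finset ι) :
    Ex P s (fun ω => Real.exp (-DD T ω)) ≤ Real.exp (-(∑ e ∈ T, P e * s ^ 2) / 2) := by
  have h1 : (fun ω : (ι → Bool) × (ι → Bool) × (ι → Bool) => Real.exp (-DD T ω)) = fun ω =>
      ∏ e, (fun (e : ι) (a b c : Bool) =>
        if e ∈ T then Real.exp (-(bi (a && b) * bi (a && c))) else 1) e (ω.1 e) (ω.2.1 e) (ω.2.2 e) := by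
    funext ω
    simp only [DD, ← Finset.sum_neg_distrib, Real.exp_sum]
    rw [Finset.prod_ite_mem, Finset.univ_inter]
  rw [h1, Ex_prod P s (fun (e : ι) (a b c : Bool) =>
        if e ∈ T then Real.exp (-(bi (a && b) * bi (a && c))) else 1), neg_div, Finset.sum_div, ← Finset.sum_neg_distrib, Real.exp_sum]
  rw [← Finset.univ_inter T, ← Finset.prod_ite_mem, Finset.univ_inter]
  have he : Real.exp (-1) ≤ 1 / 2 := by
    rw [Real.exp_neg, inv_eq_one_div]
    apply one_div_le_one_div_of_le (by norm_num)
    have := Real.add_one_le_exp (1:ℝ); linarith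
  refine Finset.prod_le_prod (fun e _ => ?_) fun e _ => ?_
  · refine Finset.sum_nonneg fun a _ => Finset.sum_nonneg fun b _ => Finset.sum_nonneg fun c _ => ?_
    have := bern_nonneg (hP0 e) (hP1 e) a
    have := bern_nonneg hs0 hs1 b
    have := bern_nonneg hs0 hs1 c
    split_ifs <;> positivity
  · split_ifs with h
    · have h2 := Real.add_one_le_exp (-(P e * s ^ 2 / 2))
      refine le_trans ?_ h2
      simp [bern, bi]
      have : 0 ≤ P e * s ^ 2 := mul_nonneg (hP0 e) (by positivity)
      nlinarith
    · apply le_of_eq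
      simp [bern]; ring

lemma Ex_ZZ_indep {P : ι → ℝ} {s pb : ℝ} (hP0 : ∀ e, 0 ≤ P e) (hPb : ∀ e, P e ≤ pb)
    (hs0 : 0 ≤ s) (τ : ι → ι) (hτ : Function.Injective τ)
    (Q : Finset ι) (hQ : ∀ e ∈ Q, τ e ∈ Q → τ e = e) (c : ℝ) (hc : 0 ≤ c) :
    Ex P s (fun ω => Real.exp (c * ZZ τ Q ω))
      ≤ Real.exp ((Real.exp c - 1) * ∑ e ∈ Q, P e * s ^ 2 * (if τ e = e then 1 else pb)) := by
  have hec : 0 ≤ Real.exp c - 1 := by have := Real.add_one_le_exp c; linarith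
  have h1 : (fun ω : (ι → Bool) × (ι → Bool) × (ι → Bool) => Real.exp (c * ZZ τ Q ω)) = fun ω =>
      ∑ U ∈ Q.powerset, (Real.exp c - 1) ^ U.card *
      ∏ f, (fun (f : ι) (a b c : Bool) =>
        (if f ∈ U then bi (a && b) else 1) * (if f ∈ U.image τ then bi (a && c) else 1))
          f (ω.1 f) (ω.2.1 f) (ω.2.2 f) := by
    funext ω
    have : Real.exp (c * ZZ τ Q ω) = ∏ e ∈ Q, (1 + (Real.exp c - 1) *
        (bi (ω.1 e && ω.2.1 e) * bi (ω.1 (τ e) && ω.2.2 (τ e)))) := by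
      rw [ZZ, Finset.mul_sum, Real.exp_sum]
      refine Finset.prod_congr rfl fun e _ => ?_
      unfold bi; split_ifs <;> simp
    rw [this, Finset.prod_one_add]
    refine Finset.sum_congr rfl fun U _ => ?_
    rw [Finset.prod_mul_distrib, Finset.prod_const, Finset.prod_mul_distrib]
    simp only [Finset.prod_mul_distrib]
    rw [Finset.prod_ite_mem, Finset.prod_ite_mem, Finset.univ_inter, Finset.univ_inter,
      Finset.prod_image fun a _ b _ h => hτ h]
  rw [h1, Ex_sum]
  have h2 : ∀ U ∈ Q.powerset, Ex P s (fun ω => (Real.exp c - 1) ^ U.card *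
      ∏ f, (fun (f : ι) (a b c : Bool) =>
        (if f ∈ U then bi (a && b) else 1) * (if f ∈ U.image τ then bi (a && c) else 1))
          f (ω.1 f) (ω.2.1 f) (ω.2.2 f)) ≤
      ∏ e ∈ U, ((Real.exp c - 1) * (P e * s ^ 2 * (if τ e = e then 1 else pb))) := by
    intro U hU
    rw [Finset.mem_powerset] at hU
    rw [Ex_smul, Ex_prod P s (fun (f : ι) (a b c : Bool) =>
        (if f ∈ U then bi (a && b) else 1) * (if f ∈ U.image τ then bi (a && c) else 1)), Finset.prod_mul_distrib, Finset.prod_const]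
    refine mul_le_mul_of_nonneg_left ?_ (by positivity)
    have h3 : ∀ f, (∑ a, ∑ b, ∑ c, bern (P f) a * bern s b * bern s c *
        ((if f ∈ U then bi (a && b) else 1) * (if f ∈ U.image τ then bi (a && c) else 1)))
        = (if f ∈ U then P f * s else 1) *
          (if f ∈ U.image τ then (if f ∈ U then 1 else P f) * s else 1) := by
      intro f
      by_cases h : f ∈ U <;> by_cases h' : f ∈ U.image τ <;> simp only [h, h'] <;>
        simp [bern, bi] <;> ring
    rw [Finset.prod_congr rfl fun f _ => h3 f, Finset.prod_mul_distrib, Finset.prod_ite_mem,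
      Finset.prod_ite_mem, Finset.univ_inter, Finset.univ_inter,
      Finset.prod_image fun a _ b _ h => hτ h, ← Finset.prod_mul_distrib]
    refine Finset.prod_le_prod (fun e _ => ?_) fun e he => ?_
    · have := hP0 e; have := hP0 (τ e)
      split_ifs <;> positivity
    · have hpe := hP0 e
      by_cases h : τ e = e
      · rw [if_pos h, if_pos (by rw [h]; exact he)]
        apply le_of_eq; ring
      · rw [if_neg h, if_neg fun h' => h (hQ e (hU he) (hU h'))]
        have := hPb (τ e)
        have : P e * s * (P (τ e) * s) = P e * s ^ 2 * P (τ e) := by ring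
        rw [this]; gcongr
  refine (Finset.sum_le_sum h2).trans ?_
  rw [← Finset.prod_one_add, Finset.mul_sum, Real.exp_sum]
  refine Finset.prod_le_prod (fun e _ => ?_) fun e _ => ?_
  · have := hP0 e
    have : 0 ≤ pb := this.trans (hPb e)
    split_ifs <;> positivity
  · rw [add_comm]; exact Real.add_one_le_exp _

lemma jensen_ZZ (τ : ι → ι) (T : Finset ι) (c : ℝ) (hc : 0 ≤ c) (ω) :
    Real.exp (c * ZZ τ T ω) ≤ ∑ R : ι → Bool, (1 / 2 : ℝ) ^ (Fintype.card ι) *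
      Real.exp ((4 * c) * ZZ τ (T.filter fun e => τ e = e ∨ (R e = true ∧ R (τ e) = false)) ω) := by
  have hz : ∀ e, 0 ≤ bi (ω.1 e && ω.2.1 e) * bi (ω.1 (τ e) && ω.2.2 (τ e)) := by
    intro e; unfold bi; split_ifs <;> norm_num
  have hone : ∑ R : ι → Bool, (1 / 2 : ℝ) ^ (Fintype.card ι) = 1 := by
    simp
  have hj := convexOn_exp.map_sum_le (t := (Finset.univ : Finset (ι → Bool)))
    (w := fun _ => (1 / 2 : ℝ) ^ (Fintype.card ι))
    (p := fun R => (4 * c) * ZZ τ (T.filter fun e => τ e = e ∨ (R e = true ∧ R (τ e) = false)) ω)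
    (fun _ _ => by positivity) hone (fun _ _ => Set.mem_univ _)
  simp only [smul_eq_mul] at hj
  refine le_trans (Real.exp_le_exp.2 ?_) hj
  have key : ∀ e, (1 / 4 : ℝ) ≤ ∑ R : ι → Bool, (1 / 2 : ℝ) ^ (Fintype.card ι) *
      (if τ e = e ∨ (R e = true ∧ R (τ e) = false) then 1 else 0) := by
    intro e
    by_cases h : τ e = e
    · simp only [h, true_or, if_true, mul_one]; rw [hone]; norm_num
    · have h4 : ∀ R : ι → Bool, (1 / 2 : ℝ) ^ (Fintype.card ι) *
          (if τ e = e ∨ (R e = true ∧ R (τ e) = false) then 1 else 0) =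
          ∏ f, (if f = e then (if R f then 1/2 else 0) else if f = τ e then
            (if R f then 0 else 1/2) else 1/2) := by
        intro R
        simp only [h, false_or]
        by_cases hh : R e = true ∧ R (τ e) = false
        · rw [if_pos hh, mul_one, ← Finset.card_univ, ← Finset.prod_const]
          refine Finset.prod_congr rfl fun f _ => ?_
          split_ifs <;> simp_all
        · rw [if_neg hh, mul_zero, eq_comm, Finset.prod_eq_zero_iff]
          by_cases h5 : R e = true
          · have h6 : R (τ e) = true := by simpa [h5] using hh
            exact ⟨τ e, Finset.mem_univ _, by simp [h, h6]⟩
          · exact ⟨e, Finset.mem_univ _, by simp [h5]⟩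
      rw [Finset.sum_congr rfl fun R _ => h4 R]
      rw [← Fintype.prod_sum (fun (f : ι) (b : Bool) => (if f = e then (if b then (1/2:ℝ) else 0)
        else if f = τ e then (if b then 0 else 1/2) else 1/2))]
      have h7 : ∀ f, (∑ b : Bool, (if f = e then (if b then (1/2:ℝ) else 0)
        else if f = τ e then (if b then 0 else 1/2) else 1/2)) =
          (if f = e then 1/2 else 1) * (if f = τ e then 1/2 else 1) := by
        intro f
        by_cases h8 : f = e
        · have : f ≠ τ e := by rw [h8]; exact fun h' => h h'.symm
          simp [h8, this, Ne.symm h]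
        · by_cases h9 : f = τ e <;> simp [h8, h9, h]
      rw [Finset.prod_congr rfl fun f _ => h7 f, Finset.prod_mul_distrib]
      simp; norm_num
  have : ∑ R : ι → Bool, (1 / 2 : ℝ) ^ (Fintype.card ι) * ((4 * c) *
      ZZ τ (T.filter fun e => τ e = e ∨ (R e = true ∧ R (τ e) = false)) ω) =
      ∑ e ∈ T, (4 * c) * (bi (ω.1 e && ω.2.1 e) * bi (ω.1 (τ e) && ω.2.2 (τ e))) *
      ∑ R : ι → Bool, (1 / 2 : ℝ) ^ (Fintype.card ι) *
      (if τ e = e ∨ (R e = true ∧ R (τ e) = false) then 1 else 0) := by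
    simp only [ZZ, Finset.mul_sum, Finset.sum_filter]
    rw [Finset.sum_comm]
    refine Finset.sum_congr rfl fun e _ => Finset.sum_congr rfl fun R _ => ?_
    split_ifs <;> ring
  rw [this, ZZ, Finset.mul_sum]
  refine Finset.sum_le_sum fun e _ => ?_
  have h1 := mul_le_mul_of_nonneg_left (key e) (mul_nonneg (by positivity : 0 ≤ 4 * c) (hz e))
  linarith

lemma Ex_ZZ {P : ι → ℝ} {s pb : ℝ} (hP0 : ∀ e, 0 ≤ P e) (hP1 : ∀ e, P e ≤ 1)
    (hPb : ∀ e, P e ≤ pb)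
    (hs0 : 0 ≤ s) (hs1 : s ≤ 1) (τ : ι → ι) (hτ : Function.Injective τ)
    (T : Finset ι) (c : ℝ) (hc : 0 ≤ c) :
    Ex P s (fun ω => Real.exp (c * ZZ τ T ω))
      ≤ Real.exp (Real.exp (4 * c) * ∑ e ∈ T, P e * s ^ 2 * (if τ e = e then 1 else pb)) := by
  have hn : ∀ e, 0 ≤ P e * s ^ 2 * (if τ e = e then 1 else pb) := by
    intro e
    have := hP0 e
    have : 0 ≤ pb := this.trans (hPb e)
    split_ifs <;> positivity
  refine (Ex_mono hP0 hP1 hs0 hs1 (jensen_ZZ τ T c hc)).trans ?_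
  rw [Ex_sum]
  have hone : ∑ R : ι → Bool, (1 / 2 : ℝ) ^ (Fintype.card ι) = 1 := by
    simp
  suffices h : ∀ R ∈ (Finset.univ : Finset (ι → Bool)), _ ≤ (1 / 2 : ℝ) ^ (Fintype.card ι) *
      Real.exp (Real.exp (4 * c) * ∑ e ∈ T, P e * s ^ 2 * (if τ e = e then 1 else pb)) by
    refine (Finset.sum_le_sum h).trans ?_
    rw [← Finset.sum_mul, hone, one_mul]
  intro R _
  rw [Ex_smul]
  refine mul_le_mul_of_nonneg_left ?_ (by positivity)
  refine (Ex_ZZ_indep hP0 hPb hs0 τ hτ _ ?_ (4 * c) (by positivity)).trans ?_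
  · intro e he h
    by_contra hne
    simp only [Finset.mem_filter] at he h
    have h1 := (he.2.resolve_left hne).2
    rcases h.2 with h2 | h2
    · exact hne (hτ h2)
    · simp [h1] at h2
  · apply Real.exp_le_exp.2
    refine mul_le_mul (by linarith) ?_ (Finset.sum_nonneg fun e _ => hn e) (Real.exp_pos _).le
    exact Finset.sum_le_sum_of_subset_of_nonneg (Finset.filter_subset _ _) fun e _ _ => hn e

end Generic

section Comb
variable {n k : ℕ}

lemma adj_lift (g : Edge n → Bool) (π : Equiv.Perm (Fin n)) (e : Edge n) :
    adj g (π e.1.1) (π e.1.2) = g (lift π e) := by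
  unfold adj lift
  by_cases h : π e.1.1 < π e.1.2
  · simp [h]
  · have h' : π e.1.2 < π e.1.1 :=
      lt_of_le_of_ne (not_lt.mp h) fun hc => e.2.ne' (π.injective hc)
    simp [h, h']

lemma adj_edge (g : Edge n → Bool) (e : Edge n) : adj g e.1.1 e.1.2 = g e := by
  unfold adj; rw [dif_pos e.2]

lemma lift_cases (π : Equiv.Perm (Fin n)) (e : Edge n) :
    ((lift π e).1.1 = π e.1.1 ∧ (lift π e).1.2 = π e.1.2) ∨
    ((lift π e).1.1 = π e.1.2 ∧ (lift π e).1.2 = π e.1.1) := by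
  unfold lift; split_ifs <;> simp

lemma lift_injective (π : Equiv.Perm (Fin n)) : Function.Injective (lift π) := by
  intro e f h
  have he := e.2; have hf := f.2
  rcases lift_cases π e with ⟨h1, h2⟩ | ⟨h1, h2⟩ <;> rcases lift_cases π f with ⟨h3, h4⟩ | ⟨h3, h4⟩ <;>
    rw [h] at h1 h2 <;> rw [h1] at h3 <;> rw [h2] at h4 <;>
    have h5 := π.injective h3 <;> have h6 := π.injective h4
  · exact Subtype.ext (Prod.ext h5 h6)
  · rw [h5, h6] at he; exact absurd he (lt_asymm hf)
  · rw [h5, h6] at he; exact absurd he (lt_asymm hf)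
  · exact Subtype.ext (Prod.ext h6 h5)

lemma adj_symm (g : Edge n → Bool) (i j : Fin n) : adj g i j = adj g j i := by
  unfold adj
  rcases lt_trichotomy i j with h | h | h
  · simp [h, lt_asymm h]
  · subst h; rfl
  · simp [h, lt_asymm h]

/-- touched edges -/
def TT (S : Finset (Fin n)) : Finset (Edge n) := univ.filter fun e => e.1.1 ∈ S ∨ e.1.2 ∈ S

/-- moved vertices -/
def SS (πs π : Equiv.Perm (Fin n)) : Finset (Fin n) := univ.filter fun i => π i ≠ πs i

lemma SS_card (σ : Fin n → Fin k) (πs π : Equiv.Perm (Fin n)) :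
    (SS πs π).card = ∑ r, xcount σ πs π r := by
  rw [Finset.card_eq_sum_card_fiberwise (f := σ) (t := univ) (fun _ _ => by simp)]
  refine Finset.sum_congr rfl fun r _ => ?_
  unfold xcount SS
  rw [Finset.filter_filter]
  congr 1; ext i; simp [and_comm]

lemma align_eq (πs π : Equiv.Perm (Fin n)) (ω : CondOmega n) :
    (align (G1adjC ω) (G2adjC πs ω) π : ℝ) = ZZ (lift (π.trans πs.symm)) univ ω := by
  unfold align ZZ
  push_cast
  refine Finset.sum_congr rfl fun e _ => ?_
  have h1 : ∀ g : Edge n → Bool, adj g (πs.symm (π e.1.1)) (πs.symm (π e.1.2)) =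
      g (lift (π.trans πs.symm) e) := fun g => by
    exact adj_lift g (π.trans πs.symm) e
  simp only [G1adjC, G2adjC, h1, adj_edge, bi]
  cases ω.1 e <;> cases ω.2.1 e <;> simp

lemma align_lift (πs π π' : Equiv.Perm (Fin n)) (ω : CondOmega n) (h : lift π = lift π') :
    align (G1adjC ω) (G2adjC πs ω) π = align (G1adjC ω) (G2adjC πs ω) π' := by
  unfold align
  refine Finset.sum_congr rfl fun e _ => ?_
  have hs : ∀ i j, G2adjC πs ω i j = G2adjC πs ω j i := by
    intro i j; unfold G2adjC
    rw [adj_symm ω.1, adj_symm ω.2.2]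
  have : G2adjC πs ω (π e.1.1) (π e.1.2) = G2adjC πs ω (π' e.1.1) (π' e.1.2) := by
    rcases lift_cases π e with ⟨h1, h2⟩ | ⟨h1, h2⟩ <;>
    rcases lift_cases π' e with ⟨h3, h4⟩ | ⟨h3, h4⟩ <;> rw [h] at h1 h2 <;>
    rw [← h1, ← h2, ← h3, ← h4]
    · exact hs _ _
    · exact hs _ _
  rw [this]

lemma lift_not_touched (πs π : Equiv.Perm (Fin n)) (e : Edge n) (he : e ∉ TT (SS πs π)) :
    lift (π.trans πs.symm) e = e := by
  simp only [TT, SS, mem_filter, mem_univ, true_and, not_or, not_not] at he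
  have h1 : (π.trans πs.symm) e.1.1 = e.1.1 := by simp [he.1]
  have h2 : (π.trans πs.symm) e.1.2 = e.1.2 := by simp [he.2]
  unfold lift
  have := e.2
  rw [dif_pos (by rw [h1, h2]; exact this)]
  exact Subtype.ext (Prod.ext h1 h2)

lemma fixed_card (πs π : Equiv.Perm (Fin n)) :
    ((TT (SS πs π)).filter fun e => lift (π.trans πs.symm) e = e).card ≤ (SS πs π).card := by
  have key : ∀ e ∈ ((TT (SS πs π)).filter fun e => lift (π.trans πs.symm) e = e),
      (π.trans πs.symm) e.1.1 = e.1.2 ∧ e.1.1 ∈ SS πs π := by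
    intro e he
    simp only [TT, SS, mem_filter, mem_univ, true_and] at he
    obtain ⟨h1, h2⟩ := he
    have hlt := e.2
    rcases lift_cases (π.trans πs.symm) e with ⟨h3, h4⟩ | ⟨h3, h4⟩ <;> rw [h2] at h3 h4
    · exfalso
      simp only [Equiv.trans_apply] at h3 h4
      rw [Equiv.eq_symm_apply] at h3 h4
      rcases h1 with h1 | h1
      · exact h1 h3.symm
      · exact h1 h4.symm
    · refine ⟨h4.symm, ?_⟩
      simp only [SS, mem_filter, mem_univ, true_and]
      simp only [Equiv.trans_apply] at h4
      rw [Equiv.eq_symm_apply] at h4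
      rw [← h4]
      exact fun h => hlt.ne (πs.injective h).symm
  refine Finset.card_le_card_of_injOn (fun e => e.1.1) (fun e he => (key e he).2) ?_
  intro e he f hf h
  have h1 := (key e he).1; have h2 := (key f hf).1
  simp only at h
  rw [h] at h1
  exact Subtype.ext (Prod.ext h (h1.symm.trans h2))

lemma perm_count (πs : Equiv.Perm (Fin n)) (S : Finset (Fin n)) :
    (univ.filter fun π => SS πs π = S).card ≤ n ^ S.card := by
  have h : n ^ S.card = (univ : Finset (S → Fin n)).card := by simp
  rw [h]
  refine Finset.card_le_card_of_injOn (fun π i => π i) (fun _ _ => by simp) ?_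
  intro π hπ π' hπ' h
  have h1 : SS πs π = S := by simpa using hπ
  have h2 : SS πs π' = S := by simpa using hπ'
  ext i
  by_cases hi : i ∈ S
  · have := congrFun h ⟨i, hi⟩
    simp only at this
    rw [this]
  · have h3 : π i = πs i := by
      have : i ∉ SS πs π := h1 ▸ hi
      simpa [SS] using this
    have h4 : π' i = πs i := by
      have : i ∉ SS πs π' := h2 ▸ hi
      simpa [SS] using this
    rw [h3, h4]

/-- edge probability -/
noncomputable def pe (σ : Fin n → Fin k) (p q : ℝ) (e : Edge n) : ℝ := if σ e.1.1 = σ e.1.2 then p else q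

/-- mean -/
noncomputable def mu (σ : Fin n → Fin k) (p q s : ℝ) (S : Finset (Fin n)) : ℝ :=
  ∑ e ∈ TT S, pe σ p q e * s ^ 2

lemma DD_le_ZZ (πs π : Equiv.Perm (Fin n)) (ω : CondOmega n)
    (h : (align (G1adjC ω) (G2adjC πs ω) πs : ℝ) ≤ align (G1adjC ω) (G2adjC πs ω) π) :
    DD (TT (SS πs π)) ω ≤ ZZ (lift (π.trans πs.symm)) (TT (SS πs π)) ω := by
  rw [align_eq, align_eq] at h
  have hid : ∀ e, lift (πs.trans πs.symm) e = e := fun e =>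
    lift_not_touched πs πs e (by simp [TT, SS])
  have h1 : ZZ (lift (πs.trans πs.symm)) univ ω = DD univ ω := by
    unfold ZZ DD
    exact Finset.sum_congr rfl fun e _ => by rw [hid]
  have h2 : DD univ ω = DD (TT (SS πs π)) ω + DD (TT (SS πs π))ᶜ ω := by
    unfold DD; rw [Finset.sum_add_sum_compl]
  have h3 : ZZ (lift (π.trans πs.symm)) univ ω = ZZ (lift (π.trans πs.symm)) (TT (SS πs π)) ω
      + ZZ (lift (π.trans πs.symm)) (TT (SS πs π))ᶜ ω := by
    unfold ZZ; rw [Finset.sum_add_sum_compl]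
  have h4 : ZZ (lift (π.trans πs.symm)) (TT (SS πs π))ᶜ ω = DD (TT (SS πs π))ᶜ ω := by
    unfold ZZ DD
    refine Finset.sum_congr rfl fun e he => ?_
    rw [lift_not_touched πs π e (Finset.mem_compl.1 he)]
  linarith

lemma one_le_sum' {κ : Type*} {t : Finset κ} {f : κ → ℝ} {i : κ} (hi : i ∈ t)
    (h0 : ∀ j ∈ t, 0 ≤ f j) (h : 1 ≤ f i) : 1 ≤ ∑ j ∈ t, f j :=
  h.trans (Finset.single_le_sum h0 hi)

set_option maxHeartbeats 1000000 in
lemma condPr_bound (σ : Fin n → Fin k) {p q s : ℝ} (hp : p ∈ Set.Icc (0:ℝ) 1)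
    (hq : q ∈ Set.Icc (0:ℝ) 1) (hs : s ∈ Set.Icc (0:ℝ) 1) (πs : Equiv.Perm (Fin n))
    (x : Fin k → ℕ) (est : (Fin n → Fin n → Bool) → (Fin n → Fin n → Bool) → Equiv.Perm (Fin n))
    (hest : ∀ A B π', align A B π' ≤ align A B (est A B)) (c : ℝ) (hc : 0 ≤ c) :
    condPr n k σ p q s
              {ω | ∃ π : Equiv.Perm (Fin n),
                  lift π = lift (est (G1adjC ω) (G2adjC πs ω))
                    ∧ ∀ r, xcount σ πs π r = x r} ≤
      ∑ S ∈ (univ : Finset (Fin n)).powersetCard (∑ r, x r),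
        (Real.exp (-mu σ p q s S / 4) + (n : ℝ) ^ (∑ r, x r) *
          Real.exp (-(c * mu σ p q s S / 4) + Real.exp (4 * c) *
            (max p q * mu σ p q s S + max p q * (∑ r, x r : ℕ)))) := by
  have hP0 : ∀ e, 0 ≤ pe σ p q e := fun e => by
    unfold pe; split_ifs; exacts [hp.1, hq.1]
  have hP1 : ∀ e, pe σ p q e ≤ 1 := fun e => by
    unfold pe; split_ifs; exacts [hp.2, hq.2]
  have hPb : ∀ e, pe σ p q e ≤ max p q := fun e => by
    unfold pe; split_ifs; exacts [le_max_left _ _, le_max_right _ _]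
  have hpb : 0 ≤ max p q := le_max_of_le_left hp.1
  set X := ∑ r, x r with hX
  have h1 : condPr n k σ p q s
              {ω | ∃ π : Equiv.Perm (Fin n),
                  lift π = lift (est (G1adjC ω) (G2adjC πs ω))
                    ∧ ∀ r, xcount σ πs π r = x r} ≤
      Ex (pe σ p q) s (fun ω => ∑ S ∈ (univ : Finset (Fin n)).powersetCard X,
        (∑ i ∈ ({0} : Finset ℕ), Real.exp (mu σ p q s S / 4) * Real.exp (-DD (TT S) ω))) +
      Ex (pe σ p q) s (fun ω => ∑ S ∈ (univ : Finset (Fin n)).powersetCard X,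
        (∑ π ∈ univ.filter (fun π => SS πs π = S), Real.exp (-(c * mu σ p q s S / 4)) *
          Real.exp (c * ZZ (lift (π.trans πs.symm)) (TT S) ω))) := by
    unfold condPr Ex
    rw [← Finset.sum_add_distrib]
    refine Finset.sum_le_sum fun ω _ => ?_
    rw [← mul_add]
    have hW : condDensity n k σ p q s ω = W (pe σ p q) s ω := rfl
    have hW0 := W_nonneg hP0 hP1 hs.1 hs.2 ω
    have hn1 : 0 ≤ (∑ S ∈ (univ : Finset (Fin n)).powersetCard X,
        (∑ i ∈ ({0} : Finset ℕ), Real.exp (mu σ p q s S / 4) * Real.exp (-DD (TT S) ω))) := by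
      positivity
    have hn2 : 0 ≤ ∑ S ∈ (univ : Finset (Fin n)).powersetCard X,
        (∑ π ∈ univ.filter (fun π => SS πs π = S), Real.exp (-(c * mu σ p q s S / 4)) *
          Real.exp (c * ZZ (lift (π.trans πs.symm)) (TT S) ω)) := by positivity
    by_cases hω : ω ∈ {ω | ∃ π : Equiv.Perm (Fin n),
                  lift π = lift (est (G1adjC ω) (G2adjC πs ω))
                    ∧ ∀ r, xcount σ πs π r = x r}
    · rw [Set.indicator_of_mem hω, hW]
      refine le_mul_of_one_le_right hW0 ?_
      obtain ⟨π, hl, hx⟩ := hω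
      have hal : align (G1adjC ω) (G2adjC πs ω) πs ≤ align (G1adjC ω) (G2adjC πs ω) π := by
        rw [align_lift πs π _ ω hl]; exact hest _ _ _
      have hal' : (align (G1adjC ω) (G2adjC πs ω) πs : ℝ) ≤ align (G1adjC ω) (G2adjC πs ω) π := by
        exact_mod_cast hal
      have hZD := DD_le_ZZ πs π ω hal'
      have hcard : (SS πs π).card = X := by
        rw [SS_card σ, hX]; exact Finset.sum_congr rfl fun r _ => hx r
      have hmem : SS πs π ∈ (univ : Finset (Fin n)).powersetCard X :=
        Finset.mem_powersetCard.2 ⟨Finset.subset_univ _, hcard⟩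
      by_cases hd : DD (TT (SS πs π)) ω ≤ mu σ p q s (SS πs π) / 4
      · have : 1 ≤ (∑ S ∈ (univ : Finset (Fin n)).powersetCard X,
          (∑ i ∈ ({0} : Finset ℕ), Real.exp (mu σ p q s S / 4) * Real.exp (-DD (TT S) ω))) := by
          refine one_le_sum' hmem (fun S _ => by positivity) ?_
          simp only [Finset.sum_singleton]
          rw [← Real.exp_add]
          apply Real.one_le_exp; linarith
        linarith
      · have : 1 ≤ ∑ S ∈ (univ : Finset (Fin n)).powersetCard X,
        (∑ π ∈ univ.filter (fun π => SS πs π = S), Real.exp (-(c * mu σ p q s S / 4)) *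
          Real.exp (c * ZZ (lift (π.trans πs.symm)) (TT S) ω)) := by
          refine one_le_sum' hmem (fun S _ => by positivity) ?_
          refine one_le_sum' (Finset.mem_filter.2 ⟨Finset.mem_univ π, rfl⟩) (fun S _ => by positivity) ?_
          rw [← Real.exp_add]
          apply Real.one_le_exp
          have := mul_nonneg hc (sub_nonneg.2 (le_trans (not_le.1 hd).le hZD))
          linarith
        linarith
    · rw [Set.indicator_of_notMem hω]
      exact mul_nonneg hW0 (add_nonneg hn1 hn2)
  refine h1.trans ?_
  rw [Ex_sum, Ex_sum, ← Finset.sum_add_distrib]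
  refine Finset.sum_le_sum fun S hS => ?_
  have hScard : S.card = X := (Finset.mem_powersetCard.1 hS).2
  rw [Ex_sum, Ex_sum]
  refine add_le_add ?_ ?_
  · rw [Finset.sum_singleton, Ex_smul]
    refine (mul_le_mul_of_nonneg_left (Ex_DD hP0 hP1 hs.1 hs.2 _) (Real.exp_pos _).le).trans ?_
    rw [← Real.exp_add]
    apply Real.exp_le_exp.2
    unfold mu; linarith
  · have hb : ∀ π ∈ univ.filter (fun π => SS πs π = S), Ex (pe σ p q) s (fun ω =>
        Real.exp (-(c * mu σ p q s S / 4)) *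
          Real.exp (c * ZZ (lift (π.trans πs.symm)) (TT S) ω)) ≤
        Real.exp (-(c * mu σ p q s S / 4) + Real.exp (4 * c) *
            (max p q * mu σ p q s S + max p q * X)) := by
      intro π hπ
      have hπ' : SS πs π = S := by simpa using hπ
      rw [Ex_smul, Real.exp_add]
      refine mul_le_mul_of_nonneg_left ?_ (Real.exp_pos _).le
      refine (Ex_ZZ hP0 hP1 hPb hs.1 hs.2 _ (lift_injective _) (TT S) c hc).trans ?_
      apply Real.exp_le_exp.2
      refine mul_le_mul_of_nonneg_left ?_ (Real.exp_pos _).le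
      have h2 : ∀ e ∈ TT S, pe σ p q e * s ^ 2 * (if lift (π.trans πs.symm) e = e then 1 else max p q)
          ≤ max p q * (pe σ p q e * s ^ 2) +
            (if lift (π.trans πs.symm) e = e then max p q else 0) := by
        intro e _
        have h0 := hP0 e; have h3 := hPb e
        have hs2 : s ^ 2 ≤ 1 := pow_le_one₀ hs.1 hs.2
        have : 0 ≤ max p q * (pe σ p q e * s ^ 2) := by positivity
        have : pe σ p q e * s ^ 2 ≤ max p q := by nlinarith [sq_nonneg s]
        split_ifs <;> linarith
      refine (Finset.sum_le_sum h2).trans ?_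
      rw [Finset.sum_add_distrib, ← Finset.mul_sum, ← Finset.sum_filter, Finset.sum_const,
        nsmul_eq_mul]
      have h5 := fixed_card πs π
      rw [hπ', hScard] at h5
      have h6 : (((TT S).filter fun e => lift (π.trans πs.symm) e = e).card : ℝ) ≤ X := by
        exact_mod_cast h5
      have := mul_le_mul_of_nonneg_right h6 hpb
      unfold mu; linarith
    refine (Finset.sum_le_sum hb).trans ?_
    rw [Finset.sum_const, nsmul_eq_mul]
    refine mul_le_mul_of_nonneg_right ?_ (Real.exp_pos _).le
    have := perm_count πs S
    rw [hScard] at this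
    exact_mod_cast this

lemma condPr_le_one (σ : Fin n → Fin k) {p q s : ℝ} (hp : p ∈ Set.Icc (0:ℝ) 1)
    (hq : q ∈ Set.Icc (0:ℝ) 1) (hs : s ∈ Set.Icc (0:ℝ) 1) (A : Set (CondOmega n)) :
    condPr n k σ p q s A ≤ 1 := by
  have hP0 : ∀ e, 0 ≤ pe σ p q e := fun e => by
    unfold pe; split_ifs; exacts [hp.1, hq.1]
  have hP1 : ∀ e, pe σ p q e ≤ 1 := fun e => by
    unfold pe; split_ifs; exacts [hp.2, hq.2]
  rw [← Ex_one (pe σ p q) s]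
  unfold condPr Ex
  refine Finset.sum_le_sum fun ω _ => ?_
  have hW : condDensity n k σ p q s ω = W (pe σ p q) s ω := rfl
  rw [mul_one, ← hW]
  exact Set.indicator_le_self' (fun ω' _ => W_nonneg hP0 hP1 hs.1 hs.2 ω') ω

end Comb

section Num

lemma mu_lower {n k : ℕ} (σ : Fin n → Fin k) {p q s ε : ℝ} (hp : 0 ≤ p) (hq : 0 ≤ q)
    (hε : ε ∈ Set.Ioo (0:ℝ) 1) (hk : 2 ≤ k) (hnk : (10:ℝ) * k ≤ n)
    (hV : ∀ r, (1 - ε / 2) * n / k ≤ (Vcard σ r : ℝ) ∧ (Vcard σ r : ℝ) ≤ (1 + ε / 2) * n / k)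
    (S : Finset (Fin n)) :
    S.card * (n * s ^ 2 * (p + ((k:ℝ) - 1) * q) / k) / 5 ≤ mu σ p q s S := by
  let w : Fin n → Fin n → ℝ := fun i j => (if σ i = σ j then p else q) * s ^ 2
  have hw0 : ∀ i j, 0 ≤ w i j := by
    intro i j
    change 0 ≤ (if σ i = σ j then p else q) * s ^ 2
    split_ifs <;> positivity
  have hws : ∀ i j, w i j = w j i := by
    intro i j
    change (if σ i = σ j then p else q) * s ^ 2 = (if σ j = σ i then p else q) * s ^ 2
    simp only [eq_comm]
  have hsub : ∀ f : Fin n × Fin n → ℝ, ∑ e : Edge n, f e.1 =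
      ∑ i, ∑ j, if i < j then f (i, j) else 0 := by
    intro f
    rw [← Fintype.sum_prod_type' (f := fun i j => if i < j then f (i, j) else 0),
      ← Finset.sum_filter]
    exact (Finset.sum_subtype (univ.filter fun x : Fin n × Fin n => x.1 < x.2) (by simp) f).symm
  have hmu : mu σ p q s S = ∑ e : Edge n, if e.1.1 ∈ S ∨ e.1.2 ∈ S then w e.1.1 e.1.2 else 0 := by
    unfold mu TT pe
    rw [Finset.sum_filter]
  have h1 : (∑ e : Edge n, if e.1.1 ∈ S then w e.1.1 e.1.2 else 0) ≤ mu σ p q s S := by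
    rw [hmu]
    refine Finset.sum_le_sum fun e _ => ?_
    have := hw0 e.1.1 e.1.2
    by_cases h : e.1.1 ∈ S
    · simp [h]
    · simp only [h, if_false]; split_ifs <;> simp [this]
  have h2 : (∑ e : Edge n, if e.1.2 ∈ S then w e.1.1 e.1.2 else 0) ≤ mu σ p q s S := by
    rw [hmu]
    refine Finset.sum_le_sum fun e _ => ?_
    have := hw0 e.1.1 e.1.2
    by_cases h : e.1.2 ∈ S
    · simp [h]
    · simp only [h, if_false]; split_ifs <;> simp [this]
  have h3 : ∑ i ∈ S, ∑ j, (if i = j then 0 else w i j) =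
      (∑ e : Edge n, if e.1.1 ∈ S then w e.1.1 e.1.2 else 0) +
      (∑ e : Edge n, if e.1.2 ∈ S then w e.1.1 e.1.2 else 0) := by
    rw [hsub (fun x => if x.1 ∈ S then w x.1 x.2 else 0),
      hsub (fun x => if x.2 ∈ S then w x.1 x.2 else 0)]
    rw [Finset.sum_comm (f := fun i j => if i < j then
      (fun x : Fin n × Fin n => if x.2 ∈ S then w x.1 x.2 else 0) (i, j) else 0)]
    rw [← Finset.sum_add_distrib, ← Finset.sum_filter_add_sum_filter_not univ (fun i => i ∈ S)
      (fun i => _ + _)]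
    rw [Finset.sum_eq_zero (s := univ.filter fun i => i ∉ S)]
    · rw [add_zero]
      refine Finset.sum_congr (by ext; simp) fun i hi => ?_
      rw [← Finset.sum_add_distrib]
      refine Finset.sum_congr rfl fun j _ => ?_
      have hi : i ∈ S := by simpa using hi
      simp only [hi, if_true]
      rcases lt_trichotomy i j with h | h | h
      · simp [h, h.ne, lt_asymm h]
      · simp [h]
      · simp [h, h.ne', lt_asymm h, hws i j]
    · intro i hi
      have hi : i ∉ S := by simpa using hi
      simp [hi]
  have hkR : (2:ℝ) ≤ k := by exact_mod_cast hk
  have hk0 : (0:ℝ) < k := by linarith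
  have h4 : ∀ i, 2 * (n * s ^ 2 * (p + ((k:ℝ) - 1) * q) / k) / 5 ≤
      ∑ j, (if i = j then 0 else w i j) := by
    intro i
    have h5 : ∑ j, (if i = j then 0 else w i j) =
        (((Vcard σ (σ i) : ℝ) - 1) * p + (n - Vcard σ (σ i)) * q) * s ^ 2 := by
      have e1 : ∑ j, (if i = j then 0 else w i j) = ∑ j, w i j - w i i := by
        rw [eq_sub_iff_add_eq]
        have : w i i = ∑ j, if i = j then w i j else 0 := by simp
        rw [this, ← Finset.sum_add_distrib]
        refine Finset.sum_congr rfl fun j _ => ?_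
        split_ifs <;> simp
      have e2 : w i i = p * s ^ 2 := by simp [w]
      have e3 : ∑ j, w i j = ((Vcard σ (σ i) : ℝ) * p + (n - Vcard σ (σ i)) * q) * s ^ 2 := by
        change ∑ j, (if σ i = σ j then p else q) * s ^ 2 = _
        rw [← Finset.sum_mul]
        congr 1
        have : ∀ j, (if σ i = σ j then p else q) = q + (if σ j = σ i then (p - q) else 0) := by
          intro j; by_cases h : σ i = σ j
          · simp [h]
          · simp [h, Ne.symm h]
        rw [Finset.sum_congr rfl fun j _ => this j, Finset.sum_add_distrib, ← Finset.sum_filter]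
        simp only [Finset.sum_const, nsmul_eq_mul, Finset.card_univ, Fintype.card_fin]
        unfold Vcard; ring
      rw [e1, e2, e3]; ring
    rw [h5]
    obtain ⟨hl, hu⟩ := hV (σ i)
    set V : ℝ := ((Vcard σ (σ i) : ℕ) : ℝ)
    set m : ℝ := n / k with hm
    have hm10 : 10 ≤ m := by rw [hm, le_div_iff₀ hk0]; exact hnk
    have hnm : (n:ℝ) = m * k := by rw [hm]; field_simp
    have hl' : (1 - ε / 2) * m ≤ V := by rw [hm]; rw [← mul_div_assoc]; exact hl
    have hu' : V ≤ (1 + ε / 2) * m := by rw [hm]; rw [← mul_div_assoc]; exact hu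
    have hε1 := hε.1; have hε2 := hε.2
    have g1 : 2 / 5 * m ≤ V - 1 := by nlinarith
    have g2 : 2 / 5 * (m * (k - 1)) ≤ n - V := by
      rw [hnm]; nlinarith
    have : 2 * (n * s ^ 2 * (p + ((k:ℝ) - 1) * q) / k) / 5 =
        (2 / 5 * m * p + 2 / 5 * (m * (k - 1)) * q) * s ^ 2 := by
      rw [hm]; field_simp
    rw [this]
    gcongr
  have h6 := Finset.sum_le_sum (s := S) fun i _ => h4 i
  rw [Finset.sum_const, nsmul_eq_mul, h3] at h6
  linarith

lemma choose_bound {n X : ℕ} {B : ℝ} (hX : 0 < X) (hB : 0 < B) (h : (n:ℝ) ≤ B * X) :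
    (n.choose X : ℝ) ≤ Real.exp (X * (Real.log B + 1)) := by
  have hX0 : (0:ℝ) < X := by exact_mod_cast hX
  have h1 : (n.choose X : ℝ) ≤ (n:ℝ) ^ X / (X.factorial : ℝ) := Nat.choose_le_pow_div X n
  have h2 : (X:ℝ) ^ X / X.factorial ≤ Real.exp X := Real.pow_div_factorial_le_exp _ hX0.le X
  have hf : (0:ℝ) < X.factorial := by exact_mod_cast Nat.factorial_pos X
  calc (n.choose X : ℝ) ≤ (n:ℝ) ^ X / (X.factorial : ℝ) := h1
    _ ≤ (B * X) ^ X / X.factorial := by gcongr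
    _ = B ^ X * ((X:ℝ) ^ X / X.factorial) := by rw [mul_pow]; ring
    _ ≤ B ^ X * Real.exp X := by gcongr
    _ = Real.exp (X * (Real.log B + 1)) := by
      rw [mul_add, mul_one, Real.exp_add]
      congr 1
      rw [Real.exp_nat_mul, Real.exp_log hB]

set_option maxHeartbeats 1000000 in
lemma final_bound {n k : ℕ} (σ : Fin n → Fin k) {p q s ε : ℝ} (hp : p ∈ Set.Icc (0:ℝ) 1)
    (hq : q ∈ Set.Icc (0:ℝ) 1) (hs : s ∈ Set.Icc (0:ℝ) 1)
    (hε : ε ∈ Set.Ioo (0:ℝ) 1) (hk : 2 ≤ k) (hn : 2 ≤ n)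
    (hV : ∀ r, (1 - ε / 2) * n / k ≤ (Vcard σ r : ℝ) ∧ (Vcard σ r : ℝ) ≤ (1 + ε / 2) * n / k)
    (πs : Equiv.Perm (Fin n))
    (x : Fin k → ℕ) (hx : ∃ r, (x r : ℝ) ≥ ε / 2 * (Vcard σ r : ℝ))
    (hkC : (k : ℝ) ≤ 1 / 10 * min (Real.sqrt (n * p * s ^ 2)) (n * q * s ^ 2))
    (hdeg : n * s ^ 2 * (p + ((k : ℝ) - 1) * q) / k > Real.log n)
    (hL : 40 * (Real.log (4 / ε) + 2) ≤ Real.log n)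
    (hpq : Real.exp 96 * max p q ≤ 1 / 4)
    (est : (Fin n → Fin n → Bool) → (Fin n → Fin n → Bool) → Equiv.Perm (Fin n))
    (hest : ∀ A B π', align A B π' ≤ align A B (est A B)) :
    condPr n k σ p q s
              {ω | ∃ π : Equiv.Perm (Fin n),
                  lift π = lift (est (G1adjC ω) (G2adjC πs ω))
                    ∧ ∀ r, xcount σ πs π r = x r} ≤
      (n : ℝ) ^ (-(min (ε / 2)
                (min (ε ^ 2 * (1 - ε) * (n * p * s ^ 2) / (100 * k * Real.log n))
                  (ε ^ 2 * ((k : ℝ) - 1) * (n * q * s ^ 2) / (100 * k * Real.log n)))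
              * ∑ r, (x r : ℝ))) := by
  obtain ⟨hp0, hp1⟩ := hp
  obtain ⟨hq0, hq1⟩ := hq
  obtain ⟨hs0, hs1⟩ := hs
  obtain ⟨hε0, hε1⟩ := hε
  have hkR : (2:ℝ) ≤ k := by exact_mod_cast hk
  have hk0 : (0:ℝ) < k := by linarith
  have hnR : (2:ℝ) ≤ n := by exact_mod_cast hn
  have hn0 : (0:ℝ) < n := by linarith
  have hL0 : 0 < Real.log n := Real.log_pos (by linarith)
  set L := Real.log n with hLdef
  set Λ := n * s ^ 2 * (p + ((k : ℝ) - 1) * q) / k with hΛ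
  have hs2 : s ^ 2 ≤ 1 := pow_le_one₀ hs0 hs1
  set u := n * p * s ^ 2 with hu
  set v := n * q * s ^ 2 with hv
  have hu0 : 0 ≤ u := by positivity
  have hv0 : 0 ≤ v := by positivity
  have hun : u ≤ n := by
    have : p * s ^ 2 ≤ 1 := mul_le_one₀ hp1 (by positivity) hs2
    rw [hu, mul_assoc]; nlinarith
  have hk2 : 100 * (k:ℝ) ^ 2 ≤ u := by
    have h1 : 10 * (k:ℝ) ≤ Real.sqrt u := by
      have := min_le_left (Real.sqrt u) v; linarith
    have h2 := Real.sq_sqrt hu0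
    nlinarith
  have hnk : (10:ℝ) * k ≤ n := by nlinarith
  have hΛuv : Λ = u / k + (k - 1) * v / k := by
    rw [hΛ, hu, hv]; field_simp
  have hvk : 0 ≤ ((k:ℝ) - 1) * v / k := by
    have : (0:ℝ) ≤ k - 1 := by linarith
    positivity
  have huk : 100 * (k:ℝ) ≤ u / k := by
    rw [le_div_iff₀ hk0]; nlinarith
  have hΛk : 100 * (k:ℝ) ≤ Λ := by rw [hΛuv]; linarith
  set X := ∑ r, x r with hX
  have hXsum : ∑ r, (x r : ℝ) = X := by rw [hX]; push_cast; rfl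
  have hXn : (n:ℝ) ≤ (4 * k / ε) * X := by
    obtain ⟨r, hr⟩ := hx
    have h1 : x r ≤ X := Finset.single_le_sum (f := x) (fun _ _ => Nat.zero_le _) (Finset.mem_univ r)
    have h1' : (x r : ℝ) ≤ X := by exact_mod_cast h1
    have h2 := (hV r).1
    have h3 : (n:ℝ) / (2 * k) ≤ (1 - ε / 2) * n / k := by
      rw [div_le_div_iff₀ (by positivity) hk0]
      have : (n:ℝ) * k * ε ≤ n * k * 1 := by gcongr
      nlinarith
    have h4 : ε / 2 * (n / (2 * k)) ≤ X := by
      have := mul_le_mul_of_nonneg_left (h3.trans h2) (by positivity : 0 ≤ ε / 2)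
      linarith
    have : (n:ℝ) = (4 * k / ε) * (ε / 2 * (n / (2 * k))) := by field_simp; norm_num
    rw [this]; gcongr
  have hXpos : 0 < X := by
    rcases Nat.eq_zero_or_pos X with h | h
    · rw [h] at hXn; simp at hXn; omega
    · exact h
  have hX1 : (1:ℝ) ≤ X := by exact_mod_cast hXpos
  have hch := choose_bound (B := 4 * k / ε) hXpos (by positivity) hXn
  have hlogB : Real.log (4 * k / ε) ≤ Real.log (4 / ε) + k := by
    have : 4 * (k:ℝ) / ε = 4 / ε * k := by ring
    rw [this, Real.log_mul (by positivity) (by positivity)]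
    have := Real.log_le_sub_one_of_pos hk0
    linarith
  have hmu := fun S => mu_lower σ (s := s) hp0 hq0 ⟨hε0, hε1⟩ hk hnk hV S
  have hmain := condPr_bound σ (s := s) ⟨hp0, hp1⟩ ⟨hq0, hq1⟩ ⟨hs0, hs1⟩ πs x est hest 24 (by norm_num)
  rw [← hX] at hmain
  refine hmain.trans ?_
  have hterm : ∀ S ∈ (univ : Finset (Fin n)).powersetCard X,
        (Real.exp (-mu σ p q s S / 4) + (n : ℝ) ^ X *
          Real.exp (-(24 * mu σ p q s S / 4) + Real.exp (4 * 24) *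
            (max p q * mu σ p q s S + max p q * (X : ℕ)))) ≤ 2 * Real.exp (-(X * Λ / 20)) := by
    intro S hS
    have hSc : S.card = X := (Finset.mem_powersetCard.1 hS).2
    have hm := hmu S
    rw [hSc] at hm
    change X * Λ / 5 ≤ _ at hm
    set m := mu σ p q s S
    have hXΛ : (X:ℝ) * 200 ≤ X * Λ := mul_le_mul_of_nonneg_left (by linarith) (by linarith)
    have hm0 : 0 ≤ m := by linarith
    have t1 : Real.exp (-m / 4) ≤ Real.exp (-(X * Λ / 20)) := Real.exp_le_exp.2 (by linarith)
    have t2 : (n : ℝ) ^ X * Real.exp (-(24 * m / 4) + Real.exp (4 * 24) *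
            (max p q * m + max p q * X)) ≤ Real.exp (-(X * Λ / 20)) := by
      have : (n:ℝ) ^ X = Real.exp (X * L) := by
        rw [Real.exp_nat_mul, hLdef, Real.exp_log hn0]
      rw [this, ← Real.exp_add]
      apply Real.exp_le_exp.2
      have e1 : Real.exp (4 * 24) * (max p q * m + max p q * X) =
          (Real.exp 96 * max p q) * (m + X) := by norm_num; ring
      have e2 : (Real.exp 96 * max p q) * (m + X) ≤ 1 / 4 * (m + X) := by gcongr
      have e3 : (X:ℝ) * L ≤ X * Λ := by gcongr
      rw [e1]
      linarith
    linarith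
  refine (Finset.sum_le_sum hterm).trans ?_
  rw [Finset.sum_const, Finset.card_powersetCard, Finset.card_univ, Fintype.card_fin, nsmul_eq_mul,
    hXsum, Real.rpow_def_of_pos hn0]
  set δ := min (ε / 2) (min (ε ^ 2 * (1 - ε) * u / (100 * k * L))
    (ε ^ 2 * ((k : ℝ) - 1) * v / (100 * k * L))) with hδ
  have hδL : L * δ ≤ Λ / 200 := by
    have hε2 : ε ^ 2 ≤ 1 := pow_le_one₀ hε0.le hε1.le
    have d1 : L * δ ≤ u / k / 100 := by
      have : δ ≤ ε ^ 2 * (1 - ε) * u / (100 * k * L) := (min_le_right _ _).trans (min_le_left _ _)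
      have h2 := mul_le_mul_of_nonneg_left this hL0.le
      have h3 : L * (ε ^ 2 * (1 - ε) * u / (100 * k * L)) = (ε ^ 2 * (1 - ε)) * (u / k / 100) := by
        field_simp
      have h4 : ε ^ 2 * (1 - ε) ≤ 1 := mul_le_one₀ hε2 (by linarith) (by linarith)
      have h5 : (ε ^ 2 * (1 - ε)) * (u / k / 100) ≤ 1 * (u / k / 100) := by gcongr
      linarith
    have d2 : L * δ ≤ (k - 1) * v / k / 100 := by
      have : δ ≤ ε ^ 2 * ((k : ℝ) - 1) * v / (100 * k * L) := (min_le_right _ _).trans (min_le_right _ _)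
      have h2 := mul_le_mul_of_nonneg_left this hL0.le
      have h3 : L * (ε ^ 2 * ((k : ℝ) - 1) * v / (100 * k * L)) = ε ^ 2 * ((k - 1) * v / k / 100) := by
        field_simp
      have h5 : ε ^ 2 * ((k - 1) * v / k / 100) ≤ 1 * ((k - 1) * v / k / 100) := by gcongr
      linarith
    rw [hΛuv]; linarith
  have h2e : (2:ℝ) ≤ Real.exp 1 := by have := Real.add_one_le_exp (1:ℝ); linarith
  calc (n.choose X : ℝ) * (2 * Real.exp (-(X * Λ / 20)))
      ≤ Real.exp (X * (Real.log (4 * k / ε) + 1)) * (Real.exp 1 * Real.exp (-(X * Λ / 20))) := by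
        gcongr
    _ = Real.exp (X * (Real.log (4 * k / ε) + 1) + (1 + -(X * Λ / 20))) := by
        rw [Real.exp_add, Real.exp_add]
    _ ≤ Real.exp (L * -(δ * X)) := by
        apply Real.exp_le_exp.2
        have g1 : Real.log (4 * k / ε) + 1 + 1 - Λ / 20 + L * δ ≤ 0 := by linarith
        have := mul_nonpos_of_nonneg_of_nonpos (by linarith : (0:ℝ) ≤ X) g1
        nlinarith

end Num

/-- Lemma `lem:prob bound 2`.
Under `p, q = o(1)`, `n p s², n q s² = ω(1)` and
`n s² (p+(k-1)q)/k > (1+ε)(1-ε)⁻² log n`, there is a constant `C > 0` such that for all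
sufficiently large `n`, every labeling `σ` in the balancedness event `F_ε`, every ground
truth `π⋆`, and all `x_1,…,x_k` with `x_r ≥ (ε/2)|V_r|` for at least one `r`, if
`k ≤ C·min(√(n p s²), n q s²)` then any alignment-maximizing estimator satisfies
`P(τ̂ ∈ S_{x_1,…,x_k} | σ, τ⋆) ≤ n^{-δ(x_1+⋯+x_k)}`, where
`δ = min(ε/2, ε²(1-ε) n p s²/(100 k log n), ε²(k-1) n q s²/(100 k log n))`. -/
theorem prob_bound_large_x
    (p q s : ℕ → ℝ) (k : ℕ → ℕ)
    (hp01 : ∀ n, p n ∈ Set.Icc (0 : ℝ) 1) (hq01 : ∀ n, q n ∈ Set.Icc (0 : ℝ) 1)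
    (hs01 : ∀ n, s n ∈ Set.Icc (0 : ℝ) 1) (hk1 : ∀ n, 1 ≤ k n)
    (hp : Tendsto p atTop (nhds 0)) (hq : Tendsto q atTop (nhds 0))
    (hnp : Tendsto (fun n : ℕ => n * p n * s n ^ 2) atTop atTop)
    (hnq : Tendsto (fun n : ℕ => n * q n * s n ^ 2) atTop atTop)
    (ε : ℝ) (hε : ε ∈ Set.Ioo (0 : ℝ) 1)
    (hdeg : ∀ᶠ n : ℕ in atTop,
        n * s n ^ 2 * (p n + ((k n : ℝ) - 1) * q n) / k n
          > (1 + ε) * ((1 - ε)⁻¹) ^ 2 * Real.log n) :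
    ∃ C > (0 : ℝ), ∀ᶠ n : ℕ in atTop, ∀ σ : Fin n → Fin (k n),
      (∀ r, (1 - ε / 2) * n / k n ≤ (Vcard σ r : ℝ)
          ∧ (Vcard σ r : ℝ) ≤ (1 + ε / 2) * n / k n) →
      ∀ πstar : Equiv.Perm (Fin n), ∀ x : Fin (k n) → ℕ,
        (∃ r, (x r : ℝ) ≥ ε / 2 * (Vcard σ r : ℝ)) →
        ((k n : ℝ) ≤ C * min (Real.sqrt (n * p n * s n ^ 2)) (n * q n * s n ^ 2)) →
        ∀ est : (Fin n → Fin n → Bool) → (Fin n → Fin n → Bool) → Equiv.Perm (Fin n),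
          (∀ A B π', align A B π' ≤ align A B (est A B)) →
          condPr n (k n) σ (p n) (q n) (s n)
              {ω | ∃ π : Equiv.Perm (Fin n),
                  lift π = lift (est (G1adjC ω) (G2adjC πstar ω))
                    ∧ ∀ r, xcount σ πstar π r = x r}
            ≤ (n : ℝ) ^ (-(min (ε / 2)
                (min (ε ^ 2 * (1 - ε) * (n * p n * s n ^ 2) / (100 * k n * Real.log n))
                  (ε ^ 2 * ((k n : ℝ) - 1) * (n * q n * s n ^ 2) / (100 * k n * Real.log n)))
              * ∑ r, (x r : ℝ))) := by
  obtain ⟨hε0, hε1⟩ := hε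
  refine ⟨1 / 10, by norm_num, ?_⟩
  have hmax : Tendsto (fun n => Real.exp 96 * max (p n) (q n)) atTop (nhds 0) := by
    have := (hp.max hq).const_mul (Real.exp 96)
    simpa using this
  have hlog : Tendsto (fun n : ℕ => Real.log n) atTop atTop :=
    Real.tendsto_log_atTop.comp tendsto_natCast_atTop_atTop
  filter_upwards [hdeg, hmax.eventually (ge_mem_nhds (by norm_num : (0:ℝ) < 1 / 4)),
    hlog.eventually_ge_atTop (40 * (Real.log (4 / ε) + 2)), eventually_ge_atTop 2]
    with n hd hm hL hn σ hV πs x hx hkC est hest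
  rcases Nat.lt_or_ge (k n) 2 with hk | hk
  · have hk' : k n = 1 := le_antisymm (by omega) (hk1 n)
    have hL0 : 0 < Real.log n := Real.log_pos (by exact_mod_cast hn)
    have h0 : min (ε / 2)
                (min (ε ^ 2 * (1 - ε) * (n * p n * s n ^ 2) / (100 * k n * Real.log n))
                  (ε ^ 2 * ((k n : ℝ) - 1) * (n * q n * s n ^ 2) / (100 * k n * Real.log n))) = 0 := by
      have e1 : ε ^ 2 * ((k n : ℝ) - 1) * (n * q n * s n ^ 2) / (100 * k n * Real.log n) = 0 := by
        rw [hk']; simp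
      rw [e1, min_eq_right, min_eq_right]
      · have := (hp01 n).1
        have : 0 ≤ 1 - ε := by linarith
        positivity
      · exact (min_le_right _ _).trans (by linarith)
    rw [h0, zero_mul, neg_zero, Real.rpow_zero]
    exact condPr_le_one σ (hp01 n) (hq01 n) (hs01 n) _
  · have hd' : n * s n ^ 2 * (p n + ((k n : ℝ) - 1) * q n) / k n > Real.log n := by
      refine lt_of_le_of_lt ?_ hd
      have hL0 : 0 < Real.log n := Real.log_pos (by exact_mod_cast hn)
      have h1 : 1 ≤ (1 - ε)⁻¹ := (one_le_inv₀ (by linarith)).2 (by linarith)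
      have h2 : 1 ≤ ((1 - ε)⁻¹) ^ 2 := one_le_pow₀ h1
      have h3 : 1 ≤ (1 + ε) * ((1 - ε)⁻¹) ^ 2 := by nlinarith
      nlinarith
    exact final_bound σ (hp01 n) (hq01 n) (hs01 n) ⟨hε0, hε1⟩ hk hn hV πs x hx hkC hd' hL hm est hest

end CSBM
end

section
/- Fix ε ∈ (0,1) and suppose n ≥ 4k/ε² and ε·|V_r| ≥ 2 for all r ∈ [k] (as holds for all sufficiently large n). Let σ : [n] → [k] satisfy (1−ε/2)·n/k ≤ |V_r| ≤ (1+ε/2)·n/k for all r ∈ [k], let π_* and π be permutations of [n] with lifted permutations τ_* = ℓ(π_*) and τ = ℓ(π), and let x_r = |{i ∈ V_r : π(i) ≠ π_*(i)}| for r ∈ [k]. If x_r ≤ (ε/2)·|V_r| for all r ∈ [k], then M⁺(τ) ≥ (1−ε)·(n/k)·(x_1+⋯+x_k) and M⁻(τ) ≥ (1−ε)·((k−1)·n/k)·(x_1+⋯+x_k). -/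
open Finset Filter

namespace CSBM

lemma lift_ne {n : ℕ} (πs π : Equiv.Perm (Fin n)) (e : Edge n)
    (h1 : ¬ (π e.1.1 = πs e.1.1 ∧ π e.1.2 = πs e.1.2))
    (h2 : ¬ (π e.1.1 = πs e.1.2 ∧ π e.1.2 = πs e.1.1)) : lift π e ≠ lift πs e := by
  intro h
  unfold lift at h
  split_ifs at h <;> simp only [Subtype.mk.injEq, Prod.mk.injEq] at h <;> tauto

lemma ordered_le {n : ℕ} (Q : Fin n → Fin n → Prop) (S : Finset (Edge n))
    (hd : ∀ i, ¬ Q i i) (h1 : ∀ e : Edge n, Q e.1.1 e.1.2 → e ∈ S)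
    (h2 : ∀ e : Edge n, Q e.1.2 e.1.1 → e ∈ S) :
    ∀ T : Finset (Fin n × Fin n), (∀ p ∈ T, Q p.1 p.2) → T.card ≤ 2 * S.card := by
  intro T hT
  have hsub : T ⊆ S.image (fun e => (e.1.1, e.1.2)) ∪ S.image (fun e => (e.1.2, e.1.1)) := by
    rintro ⟨a, b⟩ hp
    have hq := hT _ hp
    simp only at hq
    rw [mem_union, mem_image, mem_image]
    rcases lt_trichotomy a b with h | h | h
    · exact Or.inl ⟨⟨(a, b), h⟩, h1 _ hq, rfl⟩
    · subst h; exact absurd hq (hd _)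
    · exact Or.inr ⟨⟨(b, a), h⟩, h2 _ hq, rfl⟩
  have := (card_le_card hsub).trans (card_union_le _ _)
  have a1 := card_image_le (s := S) (f := fun e => (e.1.1, e.1.2))
  have a2 := card_image_le (s := S) (f := fun e => (e.1.2, e.1.1))
  omega

lemma count_le {n : ℕ} (R : Fin n → Fin n → Prop) [DecidableRel R] (hR : ∀ i j, R i j → R j i)
    (πs π : Equiv.Perm (Fin n)) :
    ∑ i ∈ univ.filter (fun i => π i ≠ πs i),
      ((univ.filter fun j => R i j ∧ j ≠ i ∧ π i ≠ πs j).card +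
        (univ.filter fun j => R i j ∧ π j = πs j).card)
      ≤ 2 * (univ.filter fun e : Edge n => R e.1.1 e.1.2 ∧ lift π e ≠ lift πs e).card := by
  classical
  set A : Finset (Fin n × Fin n) :=
    univ.filter fun p => π p.1 ≠ πs p.1 ∧ R p.1 p.2 ∧ p.2 ≠ p.1 ∧ π p.1 ≠ πs p.2 with hA
  set B : Finset (Fin n × Fin n) :=
    univ.filter fun p => π p.2 ≠ πs p.2 ∧ R p.2 p.1 ∧ π p.1 = πs p.1 with hB
  have hdis : Disjoint A B := by
    rw [disjoint_left]
    intro p h1 h2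
    simp only [hA, hB, mem_filter] at h1 h2
    exact h1.2.1 h2.2.2.2
  have hAc : A.card = ∑ i ∈ univ.filter (fun i => π i ≠ πs i),
      (univ.filter fun j => R i j ∧ j ≠ i ∧ π i ≠ πs j).card := by
    simp only [hA, card_filter, sum_filter, Fintype.sum_prod_type]
    refine sum_congr rfl fun i _ => ?_
    by_cases h : π i = πs i <;> simp [h]
  have hBc : B.card = ∑ i ∈ univ.filter (fun i => π i ≠ πs i),
      (univ.filter fun j => R i j ∧ π j = πs j).card := by
    simp only [hB, card_filter, sum_filter, Fintype.sum_prod_type]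
    rw [sum_comm]
    refine sum_congr rfl fun i _ => ?_
    by_cases h : π i = πs i <;> simp [h]
  rw [sum_add_distrib, ← hAc, ← hBc, ← card_union_of_disjoint hdis]
  refine ordered_le (fun a b => a ≠ b ∧ R a b ∧ ¬ (π a = πs a ∧ π b = πs b) ∧
    ¬ (π a = πs b ∧ π b = πs a)) _ (by simp) ?_ ?_ _ ?_
  · rintro e ⟨_, h, h1, h2⟩
    simp only [mem_filter, mem_univ, true_and]
    exact ⟨h, lift_ne _ _ _ h1 h2⟩
  · rintro e ⟨_, h, h1, h2⟩
    simp only [mem_filter, mem_univ, true_and]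
    exact ⟨hR _ _ h, lift_ne _ _ _ (by tauto) (by tauto)⟩
  · rintro ⟨a, b⟩ hp
    simp only [hA, hB, mem_union, mem_filter, mem_univ, true_and] at hp
    simp only
    rcases hp with ⟨h1, h2, h3, h4⟩ | ⟨h1, h2, h3⟩
    · exact ⟨h3.symm, h2, by tauto, by tauto⟩
    · have hne : a ≠ b := by rintro rfl; exact h1 h3
      refine ⟨hne, hR _ _ h2, by tauto, ?_⟩
      rintro ⟨h5, _⟩
      exact hne (πs.injective (h3.symm.trans h5))

lemma sum_V {n k : ℕ} (σ : Fin n → Fin k) : ∑ r, Vcard σ r = n := by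
  have := card_eq_sum_card_fiberwise (s := (univ : Finset (Fin n))) (t := (univ : Finset (Fin k)))
    (f := σ) (by simp)
  simpa [Vcard] using this.symm

lemma sum_x {n k : ℕ} (σ : Fin n → Fin k) (πs π : Equiv.Perm (Fin n)) :
    ∑ r, xcount σ πs π r = (univ.filter fun i => π i ≠ πs i).card := by
  rw [card_eq_sum_card_fiberwise (s := univ.filter fun i => π i ≠ πs i)
    (t := (univ : Finset (Fin k))) (f := σ) (by simp)]
  refine sum_congr rfl fun r _ => ?_
  rw [xcount, filter_filter]
  congr 1
  ext i
  simp [and_comm]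

/-- Lemma `lem:M bound 1`.
If the communities are `ε`-balanced, `n ≥ 4k/ε²`, `ε|V_r| ≥ 2`, and `x_r ≤ (ε/2)|V_r|` for
all `r`, then `M⁺(τ) ≥ (1-ε)(n/k)(x_1+⋯+x_k)` and `M⁻(τ) ≥ (1-ε)((k-1)n/k)(x_1+⋯+x_k)`. -/
theorem M_bound_small_x (n k : ℕ) (ε : ℝ) (hε : ε ∈ Set.Ioo (0 : ℝ) 1)
    (σ : Fin n → Fin k) (πstar π : Equiv.Perm (Fin n))
    (hn : (4 : ℝ) * k / ε ^ 2 ≤ n)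
    (hV2 : ∀ r, (2 : ℝ) ≤ ε * (Vcard σ r : ℝ))
    (hbal : ∀ r, (1 - ε / 2) * n / k ≤ (Vcard σ r : ℝ)
        ∧ (Vcard σ r : ℝ) ≤ (1 + ε / 2) * n / k)
    (hx : ∀ r, (xcount σ πstar π r : ℝ) ≤ ε / 2 * (Vcard σ r : ℝ)) :
    (1 - ε) * (n / k) * (∑ r, (xcount σ πstar π r : ℝ)) ≤ (Mplus σ πstar π : ℝ) ∧
    (1 - ε) * (((k : ℝ) - 1) * n / k) * (∑ r, (xcount σ πstar π r : ℝ))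
      ≤ (Mminus σ πstar π : ℝ) := by
  classical
  obtain ⟨h0, h1⟩ := hε
  set D := univ.filter (fun i => π i ≠ πstar i) with hD
  have hX : (∑ r, (xcount σ πstar π r : ℝ)) = D.card := by
    rw [← sum_x σ πstar π]; push_cast; rfl
  have hN : (∑ r, (Vcard σ r : ℝ)) = n := by
    rw [← Nat.cast_sum, sum_V]
  -- matched counts
  have hsplit : ∀ (R : Fin n → Prop) [DecidablePred R],
      (univ.filter fun j => R j ∧ π j = πstar j).card + (univ.filter fun j => R j ∧ π j ≠ πstar j).card
        = (univ.filter R).card := by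
    intro R _
    rw [← card_filter_add_card_filter_not (s := univ.filter R) (fun j => π j = πstar j),
      filter_filter, filter_filter]
  have hone : ∀ i, (univ.filter fun j => π i = πstar j).card ≤ 1 := by
    intro i
    rw [card_le_one]
    intro a ha b hb
    simp only [mem_filter, mem_univ, true_and] at ha hb
    exact πstar.injective (ha.symm.trans hb)
  have hVn : ∀ r, (univ.filter fun j => σ j ≠ r).card + Vcard σ r = n := by
    intro r
    have := card_filter_add_card_filter_not (s := (univ : Finset (Fin n))) (fun j => σ j = r)
    simp only [card_univ, Fintype.card_fin] at this
    unfold Vcard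
    simp only [ne_eq]
    omega
  have hxn : ∀ r, (univ.filter fun j => σ j ≠ r ∧ π j ≠ πstar j).card + xcount σ πstar π r
      = D.card := by
    intro r
    have := card_filter_add_card_filter_not (s := D) (fun j => σ j = r)
    rw [hD, filter_filter, filter_filter] at this
    unfold xcount
    rw [hD]
    simp only [ne_eq, and_comm] at this ⊢
    omega
  rcases Nat.eq_zero_or_pos k with hk | hk
  · subst hk
    simp
  have hkR : (1 : ℝ) ≤ k := by exact_mod_cast hk
  have hk0 : (0 : ℝ) < k := by linarith
  set m : ℝ := (n : ℝ) / k with hm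
  have hm4 : 4 ≤ ε ^ 2 * m := by
    rw [div_le_iff₀ (by positivity)] at hn
    rw [hm, ← mul_div_assoc, le_div_iff₀ hk0]
    linarith
  have hm0 : 0 ≤ m := by positivity
  have hlow : ∀ r, (1 - ε / 2) * m ≤ (Vcard σ r : ℝ) := by
    intro r; have := (hbal r).1; rwa [mul_div_assoc] at this
  have hem : ε ^ 2 * m ≤ ε * m := by nlinarith [mul_nonneg h0.le hm0]
  rw [hX]
  constructor
  · have hc := count_le (fun i j => σ i = σ j) (fun _ _ h => h.symm) πstar π
    have hcR : (∑ i ∈ D, (((univ.filter fun j => σ i = σ j ∧ j ≠ i ∧ π i ≠ πstar j).card +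
        (univ.filter fun j => σ i = σ j ∧ π j = πstar j).card : ℕ) : ℝ))
        ≤ 2 * (Mplus σ πstar π : ℝ) := by
      have := (Nat.cast_le (α := ℝ)).2 hc
      push_cast at this ⊢
      exact this
    have hlb := card_nsmul_le_sum D (fun i => (((univ.filter fun j => σ i = σ j ∧ j ≠ i ∧ π i ≠ πstar j).card +
        (univ.filter fun j => σ i = σ j ∧ π j = πstar j).card : ℕ) : ℝ)) (2 * ((1 - ε) * m)) ?_
    · rw [nsmul_eq_mul] at hlb
      linarith
    · intro i _
      have e1 : Vcard σ (σ i) ≤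
          (univ.filter fun j => σ i = σ j ∧ j ≠ i ∧ π i ≠ πstar j).card + 1 + 1 := by
        have hsub : (univ.filter fun j => σ j = σ i) ⊆
          ((univ.filter fun j => σ i = σ j ∧ j ≠ i ∧ π i ≠ πstar j) ∪ {i}) ∪
            (univ.filter fun j => π i = πstar j) := by
          intro j hj
          simp only [mem_filter, mem_univ, true_and, mem_union, mem_singleton] at hj ⊢
          have := hj.symm
          tauto
        have t1 := (card_le_card hsub).trans (card_union_le _ _)
        have t2 := card_union_le (univ.filter fun j => σ i = σ j ∧ j ≠ i ∧ π i ≠ πstar j) {i}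
        have t3 := hone i
        rw [card_singleton] at t2
        unfold Vcard
        omega
      have e2 : (univ.filter fun j => σ i = σ j ∧ π j = πstar j).card + xcount σ πstar π (σ i)
          = Vcard σ (σ i) := by
        have := hsplit (fun j => σ j = σ i)
        unfold xcount Vcard
        simp only [eq_comm (a := σ i)]
        exact this
      have e1R := (Nat.cast_le (α := ℝ)).2 e1
      have e2R := congrArg (Nat.cast (R := ℝ)) e2
      push_cast at e1R e2R ⊢
      have f1 := hlow (σ i)
      have f2 := hx (σ i)
      have f3 : (2 - ε / 2) * ((1 - ε / 2) * m) ≤ (2 - ε / 2) * (Vcard σ (σ i) : ℝ) :=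
        mul_le_mul_of_nonneg_left f1 (by linarith)
      nlinarith
  · rcases Nat.lt_or_ge k 2 with hk2 | hk2
    · have : k = 1 := by omega
      subst this
      simp
    have hk2R : (2 : ℝ) ≤ k := by exact_mod_cast hk2
    have hc := count_le (fun i j => σ i ≠ σ j) (fun _ _ h => h.symm) πstar π
    have hcR : (∑ i ∈ D, (((univ.filter fun j => σ i ≠ σ j ∧ j ≠ i ∧ π i ≠ πstar j).card +
        (univ.filter fun j => σ i ≠ σ j ∧ π j = πstar j).card : ℕ) : ℝ))
        ≤ 2 * (Mminus σ πstar π : ℝ) := by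
      have := (Nat.cast_le (α := ℝ)).2 hc
      push_cast at this ⊢
      exact this
    have hlb := card_nsmul_le_sum D (fun i => (((univ.filter fun j => σ i ≠ σ j ∧ j ≠ i ∧ π i ≠ πstar j).card +
        (univ.filter fun j => σ i ≠ σ j ∧ π j = πstar j).card : ℕ) : ℝ))
        (2 * ((1 - ε) * (((k : ℝ) - 1) * m))) ?_
    · rw [nsmul_eq_mul] at hlb
      rw [mul_div_assoc]
      linarith
    · intro i _
      have e1 : (univ.filter fun j => σ j ≠ σ i).card ≤
          (univ.filter fun j => σ i ≠ σ j ∧ j ≠ i ∧ π i ≠ πstar j).card + 1 := by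
        have hsub : (univ.filter fun j => σ j ≠ σ i) ⊆
          (univ.filter fun j => σ i ≠ σ j ∧ j ≠ i ∧ π i ≠ πstar j) ∪
            (univ.filter fun j => π i = πstar j) := by
          intro j hj
          simp only [mem_filter, mem_univ, true_and, mem_union] at hj ⊢
          have h' := hj.symm
          have : j ≠ i := by rintro rfl; exact hj rfl
          tauto
        have t1 := (card_le_card hsub).trans (card_union_le _ _)
        have t3 := hone i
        omega
      have e2 : (univ.filter fun j => σ i ≠ σ j ∧ π j = πstar j).card +
          (univ.filter fun j => σ j ≠ σ i ∧ π j ≠ πstar j).card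
          = (univ.filter fun j => σ j ≠ σ i).card := by
        have := hsplit (fun j => σ j ≠ σ i)
        simp only [ne_comm (a := σ i)]
        exact this
      have e1R := (Nat.cast_le (α := ℝ)).2 e1
      have e2R := congrArg (Nat.cast (R := ℝ)) e2
      have e3R := congrArg (Nat.cast (R := ℝ)) (hVn (σ i))
      have e4R := congrArg (Nat.cast (R := ℝ)) (hxn (σ i))
      push_cast at e1R e2R e3R e4R ⊢
      have s1 := add_sum_erase univ (fun r => (Vcard σ r : ℝ)) (mem_univ (σ i))
      have s2 := add_sum_erase univ (fun r => (xcount σ πstar π r : ℝ)) (mem_univ (σ i))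
      rw [hN] at s1
      rw [hX] at s2
      have s3 : ∑ r ∈ univ.erase (σ i), (xcount σ πstar π r : ℝ)
          ≤ ε / 2 * ∑ r ∈ univ.erase (σ i), (Vcard σ r : ℝ) := by
        rw [mul_sum]
        exact sum_le_sum fun r _ => hx r
      have s4 := card_nsmul_le_sum (univ.erase (σ i)) (fun r => (Vcard σ r : ℝ))
        ((1 - ε / 2) * m) (fun r _ => hlow r)
      rw [nsmul_eq_mul, card_erase_of_mem (mem_univ _), card_univ, Fintype.card_fin,
        Nat.cast_sub hk, Nat.cast_one] at s4
      set a := ∑ r ∈ univ.erase (σ i), (Vcard σ r : ℝ)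
      have f3 : (2 - ε / 2) * (((k : ℝ) - 1) * ((1 - ε / 2) * m)) ≤ (2 - ε / 2) * a :=
        mul_le_mul_of_nonneg_left s4 (by linarith)
      have f4 : 4 ≤ ε ^ 2 * (((k : ℝ) - 1) * m) := by nlinarith
      have f5 : 0 ≤ ε * (((k : ℝ) - 1) * m) :=
        mul_nonneg h0.le (mul_nonneg (by linarith) hm0)
      nlinarith

end CSBM
end
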